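/- For every acceptance mode (σ,ρ) with σ ∈ {ran, inf} and ρ ∈ {⊓, ⊆, =}, the family of ω-languages (σ,ρ,nl)-accepted by context-sensitive ω-grammars equals the family of ω-languages (σ,ρ)-accepted by single-tape Turing ω-machines: 𝓛_{σ,ρ,nl}(ω-CSG) = 𝓛_{σ,ρ}(ω-TM). -/

import Mathlib

namespace OmegaFormal

/-- σ component of an acceptance mode: `ran` (occurs at least once)
or `inf` (occurs infinitely often). -/
inductive AccSigma | ran | inf
deriving DecidableEq

/-- ρ component of an acceptance mode: `cap` (nonempty intersection, ⊓),
`sub` (⊆) or `eq` (=). -/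
inductive AccRho | cap | sub | eq
deriving DecidableEq

/-- derivation mode: leftmost (`l`) or normal (`nl`). -/
inductive DerivMode | l | nl
deriving DecidableEq

/-- `sigmaSet σ f` is ran(f) resp. inf(f). -/
def sigmaSet {Q : Type _} : AccSigma → (ℕ → Q) → Set Q
  | .ran, f => Set.range f
  | .inf, f => {q | ∀ n : ℕ, ∃ m : ℕ, n ≤ m ∧ f m = q}

/-- the binary relation denoted by ρ. -/
def rhoRel {Q : Type _} : AccRho → Set Q → Set Q → Prop
  | .cap, A, B => (A ∩ B).Nonempty
  | .sub, A, B => A ⊆ B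
  | .eq,  A, B => A = B

/-- f is (σ,ρ)-accepting w.r.t. the set 𝓕 of designated sets. -/
def IsAccepting {Q : Type _} (σ : AccSigma) (ρ : AccRho) (𝓕 : Set (Set Q)) (f : ℕ → Q) : Prop :=
  ∃ F ∈ 𝓕, rhoRel ρ (sigmaSet σ f) F

/-- the finite word `l` coincides with the prefix of the ω-word `u`. -/
def MatchesPrefix {T : Type _} (l : List T) (u : ℕ → T) : Prop :=
  ∀ (k : ℕ) (h : k < l.length), l.get ⟨k, h⟩ = u k

/-- the maximal terminal prefix of a sentential form. -/
def termPrefix {N T : Type _} : List (N ⊕ T) → List T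
  | [] => []
  | (Sum.inl _) :: _ => []
  | (Sum.inr a) :: l => a :: termPrefix l

/-- A phrase structure ω-grammar `G = (N, T, P, S, 𝓕)`:
`N` nonterminals, `T` terminals, `P` named productions `p : lhs p → rhs p`
with `lhs p ∈ N⁺`, `rhs p ∈ (N ∪ T)*`, start symbol, and
production repetition sets `acc ⊆ 2^P`. -/
structure OmegaPSG (T : Type) where
  N : Type
  [fintypeN : Fintype N]
  P : Type
  [fintypeP : Fintype P]
  lhs : P → List N
  lhs_ne : ∀ p : P, lhs p ≠ []
  rhs : P → List (N ⊕ T)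
  start : N
  acc : Set (Set P)

namespace OmegaPSG

variable {T : Type} (G : OmegaPSG T)

/-- one (normal) rewriting step using production p. -/
def Step (p : G.P) (x y : List (G.N ⊕ T)) : Prop :=
  ∃ u v : List (G.N ⊕ T),
    x = u ++ (G.lhs p).map Sum.inl ++ v ∧ y = u ++ G.rhs p ++ v

/-- one leftmost rewriting step: the rewritten occurrence starts at the
leftmost nonterminal, i.e. everything to its left is terminal. -/
def LStep (p : G.P) (x y : List (G.N ⊕ T)) : Prop :=
  ∃ u v : List (G.N ⊕ T), (∀ s ∈ u, ∃ a : T, s = Sum.inr a) ∧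
    x = u ++ (G.lhs p).map Sum.inl ++ v ∧ y = u ++ G.rhs p ++ v

def StepOf : DerivMode → G.P → List (G.N ⊕ T) → List (G.N ⊕ T) → Prop
  | .l => G.LStep
  | .nl => G.Step

/-- `L_{σ,ρ,π}(G)`: ω-words admitting an infinite π-derivation from S whose
growing terminal prefixes spell the word and whose production sequence is
(σ,ρ)-accepting w.r.t. `G.acc`. -/
def Lang (σ : AccSigma) (ρ : AccRho) (π : DerivMode) : Set (ℕ → T) :=
  {u | ∃ (s : ℕ → List (G.N ⊕ T)) (d : ℕ → G.P),
    s 0 = [Sum.inl G.start] ∧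
    (∀ i : ℕ, G.StepOf π (d i) (s i) (s (i + 1))) ∧
    (∀ n : ℕ, ∃ i : ℕ, n ≤ (termPrefix (s i)).length) ∧
    (∀ i : ℕ, MatchesPrefix (termPrefix (s i)) u) ∧
    IsAccepting σ ρ G.acc d}

/-- context-free: every left-hand side is a single nonterminal. -/
def IsCFG : Prop := ∀ p : G.P, (G.lhs p).length = 1

/-- context-sensitive (monotonic): `|β| ≥ |α|` for every production. -/
def IsCSG : Prop := ∀ p : G.P, (G.lhs p).length ≤ (G.rhs p).length

/-- right linear: productions of the form `A → uB` or `A → u`, `u ∈ T*`. -/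
def IsRLG : Prop :=
  ∀ p : G.P, (G.lhs p).length = 1 ∧
    ∃ (w : List T) (B : Option G.N),
      G.rhs p = w.map Sum.inr ++ B.toList.map Sum.inl

/-- `G` is a grammar with `$`-boundary (PSG version): with `$` = `dollar`,
`S` = `S'`, every production has one of the forms
(1) α → β, α,β ∈ N⁺ (N = nonterminals other than `$`, `S`),
(2) S → $α, α ∈ N⁺, (3) $A → a$, (4) A → ε. -/
def HasDollarBoundary (dollar S' : G.N) : Prop :=
  dollar ≠ S' ∧ G.start = S' ∧
  ∀ p : G.P,
    ((dollar ∉ G.lhs p ∧ S' ∉ G.lhs p) ∧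
      ∃ β : List G.N, β ≠ [] ∧ dollar ∉ β ∧ S' ∉ β ∧ G.rhs p = β.map Sum.inl) ∨
    (G.lhs p = [S'] ∧ ∃ α : List G.N, α ≠ [] ∧ dollar ∉ α ∧ S' ∉ α ∧
      G.rhs p = Sum.inl dollar :: α.map Sum.inl) ∨
    (∃ A : G.N, A ≠ dollar ∧ A ≠ S' ∧ G.lhs p = [dollar, A] ∧
      ∃ a : T, G.rhs p = [Sum.inr a, Sum.inl dollar]) ∨
    (∃ A : G.N, A ≠ dollar ∧ A ≠ S' ∧ G.lhs p = [A] ∧ G.rhs p = [])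

/-- `G` is a grammar with `$`-boundary (CSG version): forms (1)-(3) only,
with `|α| ≤ |β|` in form (1). -/
def HasDollarBoundaryCSG (dollar S' : G.N) : Prop :=
  dollar ≠ S' ∧ G.start = S' ∧
  ∀ p : G.P,
    ((dollar ∉ G.lhs p ∧ S' ∉ G.lhs p) ∧
      ∃ β : List G.N, β ≠ [] ∧ dollar ∉ β ∧ S' ∉ β ∧ (G.lhs p).length ≤ β.length ∧
        G.rhs p = β.map Sum.inl) ∨
    (G.lhs p = [S'] ∧ ∃ α : List G.N, α ≠ [] ∧ dollar ∉ α ∧ S' ∉ α ∧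
      G.rhs p = Sum.inl dollar :: α.map Sum.inl) ∨
    (∃ A : G.N, A ≠ dollar ∧ A ≠ S' ∧ G.lhs p = [dollar, A] ∧
      ∃ a : T, G.rhs p = [Sum.inr a, Sum.inl dollar])

end OmegaPSG

/-- `𝓛_{σ,ρ,π}(X)` for the family `X` of ω-grammars over `T` satisfying `C`. -/
def GLang (T : Type) (C : OmegaPSG T → Prop) (σ : AccSigma) (ρ : AccRho) (π : DerivMode) :
    Set (Set (ℕ → T)) :=
  {L | ∃ G : OmegaPSG T, C G ∧ L = G.Lang σ ρ π}

/-- number of non-ε labels among `b 0, …, b (i-1)`. -/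
def someCount {A : Type _} (b : ℕ → Option A) (i : ℕ) : ℕ :=
  ((Finset.range i).filter fun j => (b j).isSome = true).card

/-- the (ε-allowing) label sequence `b` concatenates to the ω-word `u`. -/
def Spells {A : Type _} (b : ℕ → Option A) (u : ℕ → A) : Prop :=
  (∀ n : ℕ, ∃ i : ℕ, n ≤ someCount b i) ∧
  ∀ i : ℕ, ∀ a : A, b i = some a → a = u (someCount b i)

/-- A finite state ω-automaton `(Q, Σ, δ, q₀, 𝓕)`. -/
structure OmegaFSA (Sig : Type) where
  Q : Type
  [fintypeQ : Fintype Q]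
  init : Q
  trans : Q → Option Sig → Q → Prop
  acc : Set (Set Q)

/-- `L_{σ,ρ}(A)` for a finite state ω-automaton. -/
def OmegaFSA.Lang {Sig : Type} (A : OmegaFSA Sig) (σ : AccSigma) (ρ : AccRho) :
    Set (ℕ → Sig) :=
  {u | ∃ (r : ℕ → A.Q) (b : ℕ → Option Sig),
    r 0 = A.init ∧ (∀ i : ℕ, A.trans (r i) (b i) (r (i + 1))) ∧
    Spells b u ∧ IsAccepting σ ρ A.acc r}

/-- `𝓛_{σ,ρ}(ω-FSA)`. -/
def FSALang (Sig : Type) (σ : AccSigma) (ρ : AccRho) : Set (Set (ℕ → Sig)) :=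
  {L | ∃ A : OmegaFSA Sig, L = A.Lang σ ρ}

/-- A pushdown ω-automaton `(Q, Σ, Γ, δ, q₀, Z₀, 𝓕)`. -/
structure OmegaPDA (Sig : Type) where
  Q : Type
  [fintypeQ : Fintype Q]
  Γ : Type
  [fintypeΓ : Fintype Γ]
  init : Q
  Z0 : Γ
  trans : Q → Option Sig → Γ → Q → List Γ → Prop
  acc : Set (Set Q)

/-- `L_{σ,ρ}(D)` for a pushdown ω-automaton. -/
def OmegaPDA.Lang {Sig : Type} (D : OmegaPDA Sig) (σ : AccSigma) (ρ : AccRho) :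
    Set (ℕ → Sig) :=
  {u | ∃ (q : ℕ → D.Q) (st : ℕ → List D.Γ) (b : ℕ → Option Sig),
    q 0 = D.init ∧ st 0 = [D.Z0] ∧
    (∀ i : ℕ, ∃ (Z : D.Γ) (γ rest : List D.Γ),
      st i = Z :: rest ∧ D.trans (q i) (b i) Z (q (i + 1)) γ ∧ st (i + 1) = γ ++ rest) ∧
    Spells b u ∧ IsAccepting σ ρ D.acc q}

/-- `𝓛_{σ,ρ}(ω-PDA)`. -/
def PDALang (Sig : Type) (σ : AccSigma) (ρ : AccRho) : Set (Set (ℕ → Sig)) :=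
  {L | ∃ D : OmegaPDA Sig, L = D.Lang σ ρ}

/-- tape head moves. -/
inductive Move | L | R | S
deriving DecidableEq

def moveHead : Move → ℕ → ℕ
  | .L, n => n - 1
  | .R, n => n + 1
  | .S, n => n

/-- A single-tape Turing ω-machine `(Q, Σ, Γ, δ, q₀, 𝓕)` (Σ ⊆ Γ via `embed`). -/
structure OmegaTM (Sig : Type) where
  Q : Type
  [fintypeQ : Fintype Q]
  Γ : Type
  [fintypeΓ : Fintype Γ]
  embed : Sig → Γ
  embed_inj : Function.Injective embed
  init : Q
  trans : Q → Γ → Q → Γ → Move → Prop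
  acc : Set (Set Q)

/-- `L_{σ,ρ}(M)`: ω-words admitting a complete non-oscillating run whose state
sequence is (σ,ρ)-accepting. -/
def OmegaTM.Lang {Sig : Type} (M : OmegaTM Sig) (σ : AccSigma) (ρ : AccRho) :
    Set (ℕ → Sig) :=
  {u | ∃ (q : ℕ → M.Q) (tape : ℕ → ℕ → M.Γ) (pos : ℕ → ℕ),
    q 0 = M.init ∧ (∀ n : ℕ, tape 0 n = M.embed (u n)) ∧ pos 0 = 0 ∧
    (∀ i : ℕ, ∃ (g : M.Γ) (m : Move),
      M.trans (q i) (tape i (pos i)) (q (i + 1)) g m ∧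
      tape (i + 1) = Function.update (tape i) (pos i) g ∧
      pos (i + 1) = moveHead m (pos i)) ∧
    (∀ n : ℕ, ∃ i : ℕ, n ≤ pos i) ∧
    (∀ n : ℕ, ∃ i0 : ℕ, ∀ i : ℕ, i0 ≤ i → pos i ≠ n) ∧
    IsAccepting σ ρ M.acc q}

/-- `𝓛_{σ,ρ}(ω-TM)`. -/
def TMLang (Sig : Type) (σ : AccSigma) (ρ : AccRho) : Set (Set (ℕ → Sig)) :=
  {L | ∃ M : OmegaTM Sig, L = M.Lang σ ρ}

/-- An m-tape Turing ω-machine. -/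
structure OmegaMTM (m : ℕ) (Sig : Type) where
  Q : Type
  [fintypeQ : Fintype Q]
  Γ : Type
  [fintypeΓ : Fintype Γ]
  embed : Sig → Γ
  embed_inj : Function.Injective embed
  blank : Γ
  init : Q
  trans : Q → (Fin m → Γ) → Q → (Fin m → Γ) → (Fin m → Move) → Prop
  acc : Set (Set Q)

/-- `L_{σ,ρ}(M)` for an m-tape Turing ω-machine (`hm : 0 < m`; the input is on
the first tape, the other tapes are initially blank; the run must be complete
and non-oscillating on the first tape). -/
def OmegaMTM.Lang {m : ℕ} {Sig : Type} (M : OmegaMTM m Sig) (hm : 0 < m)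
    (σ : AccSigma) (ρ : AccRho) : Set (ℕ → Sig) :=
  {u | ∃ (q : ℕ → M.Q) (tape : ℕ → Fin m → ℕ → M.Γ) (pos : ℕ → Fin m → ℕ),
    q 0 = M.init ∧
    (∀ n : ℕ, tape 0 ⟨0, hm⟩ n = M.embed (u n)) ∧
    (∀ j : Fin m, j ≠ ⟨0, hm⟩ → ∀ n : ℕ, tape 0 j n = M.blank) ∧
    (∀ j : Fin m, pos 0 j = 0) ∧
    (∀ i : ℕ, ∃ (g : Fin m → M.Γ) (mv : Fin m → Move),
      M.trans (q i) (fun j => tape i j (pos i j)) (q (i + 1)) g mv ∧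
      (∀ j : Fin m, tape (i + 1) j = Function.update (tape i j) (pos i j) (g j)) ∧
      (∀ j : Fin m, pos (i + 1) j = moveHead (mv j) (pos i j))) ∧
    (∀ n : ℕ, ∃ i : ℕ, n ≤ pos i ⟨0, hm⟩) ∧
    (∀ n : ℕ, ∃ i0 : ℕ, ∀ i : ℕ, i0 ≤ i → pos i ⟨0, hm⟩ ≠ n) ∧
    IsAccepting σ ρ M.acc q}

/-- `𝓛_{σ,ρ}(m-ω-TM)`. -/
def MTMLang (Sig : Type) (m : ℕ) (hm : 0 < m) (σ : AccSigma) (ρ : AccRho) :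
    Set (Set (ℕ → Sig)) :=
  {L | ∃ M : OmegaMTM m Sig, L = M.Lang hm σ ρ}

/-- the ω-language `{aⁿbⁿ | n ≥ 1}^ω` over the alphabet `Bool`
(`false` = a, `true` = b). -/
def abLang : Set (ℕ → Bool) :=
  {u | ∃ n : ℕ → ℕ, (∀ i : ℕ, 1 ≤ n i) ∧
    ∀ i k : ℕ, k < 2 * n i →
      u ((∑ j ∈ Finset.range i, 2 * n j) + k) = decide (n i ≤ k)}

end OmegaFormal
open OmegaFormal

namespace OmegaFormal

/-! ### Acceptance along label-erasing projections -/

/-- The labels carried by the elements of `A`. -/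
def labels {X Y : Type*} (lab : X → Option Y) (A : Set X) : Set Y :=
  {y | ∃ x ∈ A, lab x = some y}

/-- The designated sets over `X` which express the condition `𝓕` on the labels. -/
def liftAcc {X Y : Type*} (lab : X → Option Y) (𝓕 : Set (Set Y)) : AccRho → Set (Set X)
  | .cap => {A | ∃ F ∈ 𝓕, A = {x | ∃ y ∈ F, lab x = some y}}
  | .sub => {A | ∃ F ∈ 𝓕, labels lab A ⊆ F}
  | .eq => {A | labels lab A ∈ 𝓕}

/-- Erasing the `none` entries of `lab` leaves the infinite sequence `e`; `cnt i` is the number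
of labels among the first `i` entries. -/
structure Stutter {Y : Type*} (lab : ℕ → Option Y) (e : ℕ → Y) (cnt : ℕ → ℕ) : Prop where
  zero : cnt 0 = 0
  step : ∀ i, (lab i = none ∧ cnt (i + 1) = cnt i) ∨
    (lab i = some (e (cnt i)) ∧ cnt (i + 1) = cnt i + 1)
  unbounded : ∀ k, ∃ i, k ≤ cnt i

namespace Stutter

variable {Y : Type*} {lab : ℕ → Option Y} {e : ℕ → Y} {cnt : ℕ → ℕ}

theorem mono (h : Stutter lab e cnt) : Monotone cnt :=
  monotone_nat_of_le_succ fun i => by rcases h.step i with h | h <;> omega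

theorem exists_active (h : Stutter lab e cnt) (k : ℕ) :
    ∃ i, cnt i = k ∧ lab i = some (e k) ∧ cnt (i + 1) = k + 1 := by
  classical
  have hex : ∃ i, k + 1 ≤ cnt i := h.unbounded _
  obtain ⟨j, hj⟩ : ∃ j, Nat.find hex = j + 1 := by
    refine Nat.exists_eq_succ_of_ne_zero fun h0 => ?_
    have := Nat.find_spec hex
    rw [h0, h.zero] at this
    omega
  have h1 := Nat.find_spec hex
  have h2 : ¬ k + 1 ≤ cnt j := Nat.find_min hex (by omega)
  rw [hj] at h1
  rcases h.step j with ⟨_, h3⟩ | ⟨h3, h4⟩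
  · omega
  · have : cnt j = k := by omega
    exact ⟨j, this, this ▸ h3, by omega⟩

theorem le_self (h : Stutter lab e cnt) (i : ℕ) : cnt i ≤ i := by
  induction i with
  | zero => simp [h.zero]
  | succ i ih => rcases h.step i with h | h <;> omega

theorem labels_sigmaSet {X : Type*} [Finite X] {d : ℕ → X} {l : X → Option Y}
    (h : Stutter (fun i => l (d i)) e cnt) (σ : AccSigma) :
    labels l (sigmaSet σ d) = sigmaSet σ e := by
  cases σ with
  | ran =>
    ext y
    constructor
    · rintro ⟨_, ⟨i, rfl⟩, hi⟩
      rcases h.step i with h1 | h1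
      · simp [hi] at h1
      · exact ⟨cnt i, by simpa [hi] using h1.1.symm⟩
    · rintro ⟨k, rfl⟩
      obtain ⟨i, -, hi, -⟩ := h.exists_active k
      exact ⟨d i, ⟨i, rfl⟩, hi⟩
  | inf =>
    ext y
    constructor
    · rintro ⟨x, hx, hl⟩ n
      obtain ⟨i0, hi0⟩ := h.unbounded n
      obtain ⟨i, hi, rfl⟩ := hx i0
      refine ⟨cnt i, hi0.trans (h.mono hi), ?_⟩
      rcases h.step i with h1 | h1
      · simp [hl] at h1
      · simpa [hl] using h1.1.symm
    · intro hy
      by_contra hcon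
      have key : ∀ x : X, ∃ n : ℕ, l x = some y → ∀ m, n ≤ m → d m ≠ x := by
        intro x
        by_cases hx : l x = some y
        · have : x ∉ sigmaSet .inf d := fun hmem => hcon ⟨x, hmem, hx⟩
          simp only [sigmaSet, Set.mem_ofPred_eq, not_forall, not_exists, not_and] at this
          obtain ⟨n, hn⟩ := this
          exact ⟨n, fun _ => hn⟩
        · exact ⟨0, fun h => absurd h hx⟩
      choose b hb using key
      obtain ⟨B, hB⟩ := (Set.finite_range b).bddAbove
      obtain ⟨k, hk, rfl⟩ := hy B
      obtain ⟨i, hi, hl, -⟩ := h.exists_active k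
      refine hb (d i) hl i ?_ rfl
      have := hB ⟨d i, rfl⟩
      have := h.le_self i
      omega

theorem isAccepting_iff {X : Type*} [Finite X] {d : ℕ → X} {l : X → Option Y}
    (h : Stutter (fun i => l (d i)) e cnt) (σ : AccSigma) (ρ : AccRho) (𝓕 : Set (Set Y)) :
    IsAccepting σ ρ (liftAcc l 𝓕 ρ) d ↔ IsAccepting σ ρ 𝓕 e := by
  have hl := h.labels_sigmaSet σ
  unfold IsAccepting
  rw [← hl]
  cases ρ with
  | cap =>
    constructor
    · rintro ⟨_, ⟨F, hF, rfl⟩, x, hx, y, hy, hxy⟩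
      exact ⟨F, hF, y, ⟨x, hx, hxy⟩, hy⟩
    · rintro ⟨F, hF, y, ⟨x, hx, hxy⟩, hy⟩
      exact ⟨_, ⟨F, hF, rfl⟩, x, hx, y, hy, hxy⟩
  | sub =>
    constructor
    · rintro ⟨A, ⟨F, hF, hA⟩, hs⟩
      exact ⟨F, hF, fun y ⟨x, hx, hxy⟩ => hA ⟨x, hs hx, hxy⟩⟩
    · rintro ⟨F, hF, hs⟩
      exact ⟨_, ⟨F, hF, hs⟩, subset_rfl⟩
  | eq =>
    constructor
    · rintro ⟨A, hA, hs⟩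
      exact ⟨labels l A, hA, congrArg _ hs⟩
    · rintro ⟨F, hF, hs⟩
      exact ⟨_, show labels l _ ∈ 𝓕 from hs ▸ hF, rfl⟩

end Stutter

/-- A sequence which only changes at infinitely many labelled positions can be sped up. -/
theorem exists_stutter {X Y : Type*} (C : ℕ → X) (lab : ℕ → Option Y)
    (hnone : ∀ i, lab i = none → C (i + 1) = C i) (hinf : ∀ n, ∃ i, n ≤ i ∧ lab i ≠ none) :
    ∃ (D : ℕ → X) (e : ℕ → Y) (cnt : ℕ → ℕ), Stutter lab e cnt ∧ ∀ i, C i = D (cnt i) := by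
  classical
  have hset : {i | lab i ≠ none}.Infinite := by
    refine Set.infinite_of_not_bddAbove fun ⟨B, hB⟩ => ?_
    obtain ⟨i, hi, hl⟩ := hinf (B + 1)
    have := hB hl
    omega
  have hnth : ∀ k, lab (Nat.nth (fun i => lab i ≠ none) k) ≠ none := fun k =>
    Nat.nth_mem_of_infinite hset k
  choose e he using fun k => Option.ne_none_iff_exists'.1 (hnth k)
  refine ⟨fun k => C (Nat.nth (fun i => lab i ≠ none) k), e,
    Nat.count fun i => lab i ≠ none, ⟨by simp, fun i => ?_, fun k => ?_⟩, fun i => ?_⟩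
  · by_cases h : lab i = none
    · left; simp [h, Nat.count_succ]
    · right
      refine ⟨?_, by simp [h, Nat.count_succ]⟩
      rw [← he, Nat.nth_count h]
  · exact ⟨_, (Nat.count_nth_of_infinite hset k).ge⟩
  · obtain ⟨j, hij, hj⟩ := hinf i
    induction hij using Nat.decreasingInduction with
    | self => exact congrArg C (Nat.nth_count (p := fun i => lab i ≠ none) hj).symm
    | of_succ m hm ih =>
      by_cases h : lab m = none
      · have h1 := hnone m h
        simp only [Nat.count_succ, h, ne_eq, not_true_eq_false, if_false, add_zero] at ih
        rw [← h1]
        exact ih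
      · exact congrArg C (Nat.nth_count (p := fun i => lab i ≠ none) h).symm

/-- A counter which increases whenever a well-founded measure fails to decrease is unbounded. -/
theorem unbounded_of_measure {α : Type*} [Preorder α] [WellFoundedLT α] (cnt : ℕ → ℕ) (μ : ℕ → α)
    (h : ∀ i, (cnt (i + 1) = cnt i ∧ μ (i + 1) < μ i) ∨ cnt (i + 1) = cnt i + 1) (k : ℕ) :
    ∃ i, k ≤ cnt i := by
  have key : ∀ a i, μ i = a → ∃ j, cnt j = cnt i + 1 := by
    intro a
    induction a using WellFoundedLT.induction with
    | ind a ih =>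
      rintro i rfl
      rcases h i with ⟨h1, h2⟩ | h1
      · obtain ⟨j, hj⟩ := ih _ h2 _ rfl
        exact ⟨j, h1 ▸ hj⟩
      · exact ⟨i + 1, h1⟩
  induction k with
  | zero => exact ⟨0, by omega⟩
  | succ k ih =>
    obtain ⟨i, hi⟩ := ih
    obtain ⟨j, hj⟩ := key _ i rfl
    exact ⟨j, by omega⟩

theorem exists_seq_of_forall_exists {X : Type*} {P : X → Prop} {R : X → X → Prop} {x₀ : X}
    (h₀ : P x₀) (h : ∀ x, P x → ∃ y, P y ∧ R x y) :
    ∃ f : ℕ → X, f 0 = x₀ ∧ (∀ i, P (f i)) ∧ ∀ i, R (f i) (f (i + 1)) := by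
  choose g hg using h
  let f : ℕ → {x // P x} := fun n =>
    Nat.rec ⟨x₀, h₀⟩ (fun _ x => ⟨g x.1 x.2, (hg x.1 x.2).1⟩) n
  exact ⟨fun i => (f i).1, rfl, fun i => (f i).2, fun i => (hg (f i).1 (f i).2).2⟩

/-! ### Terminal prefixes -/

section TermPrefix

variable {N T : Type*}

theorem termPrefix_append_inl (x v : List (N ⊕ T)) (A : N) :
    termPrefix (x ++ Sum.inl A :: v) = termPrefix x := by
  induction x with
  | nil => rfl
  | cons X x ih => cases X <;> simp [termPrefix, ih]

theorem termPrefix_prefix_append (x v : List (N ⊕ T)) :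
    termPrefix x <+: termPrefix (x ++ v) := by
  induction x with
  | nil => simp [termPrefix]
  | cons X x ih => cases X <;> simp [termPrefix, ih]

theorem map_inr_termPrefix_isPrefix (s : List (N ⊕ T)) : (termPrefix s).map Sum.inr <+: s := by
  induction s with
  | nil => simp [termPrefix]
  | cons X x ih => cases X <;> simp [termPrefix, ih]

theorem termPrefix_map_inr_append (l : List T) (s : List (N ⊕ T)) :
    termPrefix (l.map Sum.inr ++ s) = l ++ termPrefix s := by
  induction l with
  | nil => simp
  | cons a l ih => simp [termPrefix, ih]

theorem getElem?_of_lt_termPrefix {s : List (N ⊕ T)} {i : ℕ} (h : i < (termPrefix s).length) :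
    s[i]? = some (Sum.inr (termPrefix s)[i]) := by
  have := List.prefix_iff_getElem?.1 (map_inr_termPrefix_isPrefix s) i (by simpa using h)
  simpa using this

theorem length_termPrefix_le {s : List (N ⊕ T)} {i : ℕ} {A : N}
    (h : s[i]? = some (Sum.inl A)) : (termPrefix s).length ≤ i := by
  by_contra hlt
  simp [getElem?_of_lt_termPrefix (not_le.1 hlt)] at h

theorem le_length_termPrefix {s : List (N ⊕ T)} {b : ℕ}
    (h : ∀ i < b, ∃ a, s[i]? = some (Sum.inr a)) : b ≤ (termPrefix s).length := by
  induction s generalizing b with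
  | nil =>
    by_contra hb
    simpa using h 0 (by omega)
  | cons X s ih =>
    rcases b with _ | b
    · simp
    · obtain ⟨a, ha⟩ := h 0 (by omega)
      obtain rfl : X = Sum.inr a := by simpa using ha
      have := ih (b := b) fun i hi => by simpa using h (i + 1) (by omega)
      simpa [termPrefix] using this

end TermPrefix

theorem OmegaPSG.Step.termPrefix_isPrefix {T : Type} {G : OmegaPSG T} {p : G.P}
    {x y : List (G.N ⊕ T)} (h : G.Step p x y) : termPrefix x <+: termPrefix y := by
  obtain ⟨u, v, rfl, rfl⟩ := h
  obtain ⟨A, l, hl⟩ := List.exists_cons_of_ne_nil (G.lhs_ne p)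
  rw [hl, List.map_cons, List.append_assoc, List.cons_append, termPrefix_append_inl,
    List.append_assoc]
  exact termPrefix_prefix_append _ _

/-! ### Configurations of Turing ω-machines -/

namespace OmegaTM

variable {T : Type} (M : OmegaTM T)

/-- A configuration: state, tape content and head position. -/
structure Cfg where
  q : M.Q
  tape : ℕ → M.Γ
  pos : ℕ

/-- The initial configuration on the ω-word `u`. -/
def initCfg (u : ℕ → T) : M.Cfg := ⟨M.init, fun n => M.embed (u n), 0⟩

/-- One step of the machine. -/
def CfgStep (c c' : M.Cfg) : Prop :=
  ∃ (g : M.Γ) (m : Move), M.trans c.q (c.tape c.pos) c'.q g m ∧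
    c'.tape = Function.update c.tape c.pos g ∧ c'.pos = moveHead m c.pos

theorem mem_lang_iff {σ : AccSigma} {ρ : AccRho} {u : ℕ → T} :
    u ∈ M.Lang σ ρ ↔ ∃ D : ℕ → M.Cfg, D 0 = M.initCfg u ∧ (∀ i, M.CfgStep (D i) (D (i + 1))) ∧
      (∀ n, ∃ i₀, ∀ i, i₀ ≤ i → n < (D i).pos) ∧ IsAccepting σ ρ M.acc fun i => (D i).q := by
  constructor
  · rintro ⟨q, tape, pos, hq, ht, hp, hstep, -, hosc, hacc⟩
    refine ⟨fun i => ⟨q i, tape i, pos i⟩, ?_, hstep, fun n => ?_, hacc⟩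
    · simp [initCfg, hq, hp, funext ht]
    · induction n with
      | zero =>
        obtain ⟨i₀, h⟩ := hosc 0
        exact ⟨i₀, fun i hi => Nat.pos_of_ne_zero (h i hi)⟩
      | succ n ih =>
        obtain ⟨i₀, h₀⟩ := ih
        obtain ⟨i₁, h₁⟩ := hosc (n + 1)
        refine ⟨max i₀ i₁, fun i hi => ?_⟩
        have h2 := h₀ i (le_trans (le_max_left _ _) hi)
        have h3 := h₁ i (le_trans (le_max_right _ _) hi)
        dsimp only at h2 ⊢
        omega
  · rintro ⟨D, h0, hstep, hpos, hacc⟩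
    refine ⟨fun i => (D i).q, fun i => (D i).tape, fun i => (D i).pos, ?_, ?_, ?_, hstep, ?_, ?_,
      hacc⟩
    · simp [h0, initCfg]
    · simp [h0, initCfg]
    · simp [h0, initCfg]
    · intro n
      obtain ⟨i, hi⟩ := hpos n
      exact ⟨i, (hi i le_rfl).le⟩
    · intro n
      obtain ⟨i, hi⟩ := hpos n
      exact ⟨i, fun j hj => (hi j hj).ne'⟩

/-! ### From Turing ω-machines to context-sensitive ω-grammars -/

/-- Nonterminals of the grammar simulating `M`: the right end of the generated tape segment
(which is the start symbol as long as nothing has been generated), and tape cells. A cell records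
whether it is the leftmost one, its input letter, its current content and, if the head is there,
the current state. -/
inductive CellSym
  | endm (empty : Bool)
  | cell (first : Bool) (a : T) (g : M.Γ) (h : Option M.Q)

instance [Finite T] : Finite M.CellSym := by
  have := M.fintypeQ
  have := M.fintypeΓ
  refine Finite.of_injective (β := Bool ⊕ (Bool × T × M.Γ × Option M.Q)) (fun
    | .endm z => .inl z
    | .cell f a g h => .inr (f, a, g, h)) ?_
  rintro (_ | _) (_ | _) h <;> simp_all

open CellSym in
/-- `M.Rule α β l`: the grammar simulating `M` has a production `α → β`; it performs a step of `M`
from state `q` if `l = some q`, and no step if `l = none`. -/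
inductive Rule : List M.CellSym → List (M.CellSym ⊕ T) → Option M.Q → Prop
  | grow (z a) : Rule [endm z]
      [.inl (cell z a (M.embed a) (if z then some M.init else none)), .inl (endm false)] none
  | emit (f a g) : Rule [cell f a g none] [.inr a] none
  | stay (f a g q g' q') : M.trans q g q' g' .S →
      Rule [cell f a g (some q)] [.inl (cell f a g' (some q'))] (some q)
  | right (f a g q g' q' f₁ a₁ g₁) : M.trans q g q' g' .R →
      Rule [cell f a g (some q), cell f₁ a₁ g₁ none]
        [.inl (cell f a g' none), .inl (cell f₁ a₁ g₁ (some q'))] (some q)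
  | left (f a g q g' q' f₁ a₁ g₁) : M.trans q g q' g' .L →
      Rule [cell f₁ a₁ g₁ none, cell f a g (some q)]
        [.inl (cell f₁ a₁ g₁ (some q')), .inl (cell f a g' none)] (some q)
  | leftFirst (a g q g' q') : M.trans q g q' g' .L →
      Rule [cell true a g (some q)] [.inl (cell true a g' (some q'))] (some q)

/-- The productions of the grammar simulating `M`. -/
def RuleType : Type :=
  {r : List M.CellSym × List (M.CellSym ⊕ T) × Option M.Q // M.Rule r.1 r.2.1 r.2.2}

instance [Finite T] : Finite M.RuleType := by
  have := M.fintypeQ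
  have h : ({l : List M.CellSym | l.length ≤ 2} ×ˢ ({l : List (M.CellSym ⊕ T) | l.length ≤ 2} ×ˢ
      (Set.univ : Set (Option M.Q)))).Finite :=
    (List.finite_length_le _ _).prod ((List.finite_length_le _ _).prod Set.finite_univ)
  refine (h.subset (t := {r | M.Rule r.1 r.2.1 r.2.2}) ?_).to_subtype
  rintro ⟨α, β, l⟩ hr
  change M.Rule α β l at hr
  cases hr <;> simp

/-- The context-sensitive grammar simulating `M`. -/
noncomputable def toGrammar [Finite T] (ρ : AccRho) : OmegaPSG T where
  N := M.CellSym
  fintypeN := Fintype.ofFinite _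
  P := M.RuleType
  fintypeP := Fintype.ofFinite _
  lhs p := p.1.1
  lhs_ne := by
    rintro ⟨⟨α, β, l⟩, hr⟩
    change M.Rule α β l at hr
    cases hr <;> simp
  rhs p := p.1.2.1
  start := .endm true
  acc := liftAcc (fun p => p.1.2.2) M.acc ρ

theorem toGrammar_isCSG [Finite T] (ρ : AccRho) : (M.toGrammar ρ).IsCSG := by
  rintro ⟨⟨α, β, l⟩, hr⟩
  change α.length ≤ β.length
  change M.Rule α β l at hr
  cases hr <;> simp

/-- Rewriting with a rule of the simulating grammar. -/
def RuleStep (l : Option M.Q) (s s' : List (M.CellSym ⊕ T)) : Prop :=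
  ∃ α β x y, M.Rule α β l ∧ s = x ++ α.map Sum.inl ++ y ∧ s' = x ++ β ++ y

theorem exists_step_iff [Finite T] {ρ : AccRho} {l : Option M.Q} {s s' : List (M.CellSym ⊕ T)} :
    (∃ p : M.RuleType, (M.toGrammar ρ).Step p s s' ∧ p.1.2.2 = l) ↔ M.RuleStep l s s' := by
  constructor
  · rintro ⟨⟨⟨α, β, l⟩, hr⟩, ⟨x, y, h1, h2⟩, rfl⟩
    exact ⟨α, β, x, y, hr, h1, h2⟩
  · rintro ⟨α, β, x, y, hr, h1, h2⟩
    exact ⟨⟨⟨α, β, l⟩, hr⟩, ⟨x, y, h1, h2⟩, rfl⟩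

/-- The input letter carried by a symbol. -/
def letter : M.CellSym ⊕ T → Option T
  | .inl (.endm _) => none
  | .inl (.cell _ a _ _) => some a
  | .inr a => some a

variable {M}

theorem RuleStep.letters {l : Option M.Q} {s s' : List (M.CellSym ⊕ T)} (h : M.RuleStep l s s')
    {L : List T} (hL : s.map M.letter = L.map some ++ [none]) :
    ∃ L', L <+: L' ∧ s'.map M.letter = L'.map some ++ [none] := by
  obtain ⟨α, β, x, y, hr, rfl, rfl⟩ := h
  cases hr with
  | grow z a =>
    simp only [List.map_append, List.map_cons, List.map_nil, letter, List.append_assoc,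
      List.cons_append, List.nil_append] at hL
    have hx : x.map M.letter = L.map some ∧ y.map M.letter = [] := by
      rcases List.append_eq_append_iff.1 hL with ⟨t, h1, h2⟩ | ⟨t, h1, h2⟩
      · rcases t with _ | ⟨b, t⟩
        · simp_all
        · have : (none : Option T) ∈ L.map some := by
            rw [h1]
            simp at h2 ⊢
            simp [h2.1]
          simp at this
      · rcases t with _ | ⟨b, t⟩ <;> simp_all
    refine ⟨L ++ [a], by simp, ?_⟩
    simp [letter, hx]
  | _ => exact ⟨L, List.prefix_rfl, by rw [← hL]; simp [letter]⟩

end OmegaTM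

section Replace

variable {X : Type*}

theorem replace_one_iff {s s' : List X} {A B : X} :
    (∃ x y, s = x ++ [A] ++ y ∧ s' = x ++ [B] ++ y) ↔
      ∃ i : ℕ, s[i]? = some A ∧ ∀ j, s'[j]? = if j = i then some B else s[j]? := by
  constructor
  · rintro ⟨x, y, rfl, rfl⟩
    refine ⟨x.length, by simp, fun j => ?_⟩
    simp only [List.getElem?_append, List.length_append, List.length_singleton]
    grind
  · rintro ⟨i, hi, h⟩
    refine ⟨s.take i, s.drop (i + 1), List.ext_getElem? fun j => ?_,
      List.ext_getElem? fun j => ?_⟩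
    all_goals
      simp only [h, List.getElem?_append, List.length_append, List.length_take,
        List.length_singleton, List.getElem?_take, List.getElem?_drop]
      grind

theorem replace_two_iff {s s' : List X} {A A' B B' : X} :
    (∃ x y, s = x ++ [A, A'] ++ y ∧ s' = x ++ [B, B'] ++ y) ↔
      ∃ i : ℕ, s[i]? = some A ∧ s[i + 1]? = some A' ∧
        ∀ j, s'[j]? = if j = i then some B else if j = i + 1 then some B' else s[j]? := by
  constructor
  · rintro ⟨x, y, rfl, rfl⟩
    refine ⟨x.length, by simp, by simp, fun j => ?_⟩
    simp only [List.getElem?_append, List.length_append, List.length_cons, List.length_nil]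
    grind
  · rintro ⟨i, hi, hi', h⟩
    refine ⟨s.take i, s.drop (i + 2), List.ext_getElem? fun j => ?_,
      List.ext_getElem? fun j => ?_⟩
    all_goals
      simp only [h, List.getElem?_append, List.length_append, List.length_take,
        List.length_cons, List.length_nil, List.getElem?_take, List.getElem?_drop]
      grind

end Replace

namespace OmegaTM

variable {T : Type} {M : OmegaTM T}

/-- The symbol at position `i` of a sentential form describing the configuration `c` on input `u`;
`em` tells which positions have been turned into terminals. -/
def entry (u : ℕ → T) (em : ℕ → Bool) (c : M.Cfg) (i : ℕ) : M.CellSym ⊕ T :=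
  if em i then .inr (u i)
  else .inl (.cell (i == 0) (u i) (c.tape i) (if i = c.pos then some c.q else none))

/-- The sentential form describing the first `n` cells of the configuration `c`. -/
def form (u : ℕ → T) (n : ℕ) (em : ℕ → Bool) (c : M.Cfg) : List (M.CellSym ⊕ T) :=
  (List.range n).map (entry u em c) ++ [.inl (.endm (n == 0))]

theorem getElem?_form (u : ℕ → T) (n : ℕ) (em : ℕ → Bool) (c : M.Cfg) (i : ℕ) :
    (form u n em c)[i]? = if i < n then some (entry u em c i)
      else if i = n then some (.inl (.endm (n == 0))) else none := by
  simp only [form, List.getElem?_append, List.length_map, List.length_range]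
  grind

theorem form_succ (u : ℕ → T) (n : ℕ) (em : ℕ → Bool) (c : M.Cfg) :
    form u (n + 1) em c = (List.range n).map (entry u em c) ++
      [entry u em c n, .inl (.endm false)] := by
  simp [form, List.range_succ]

/-- `form u n em c` is a faithful description of `c`. -/
structure Faithful (u : ℕ → T) (n : ℕ) (em : ℕ → Bool) (c : M.Cfg) : Prop where
  init : n = 0 → c = M.initCfg u
  pos_lt : n ≠ 0 → c.pos < n
  em_pos : em c.pos = false
  em_lt : ∀ i, em i = true → i < n
  tape : ∀ i, n ≤ i → c.tape i = M.embed (u i)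

theorem Faithful.entry_last {u : ℕ → T} {n : ℕ} {em : ℕ → Bool} {c : M.Cfg}
    (h : Faithful u n em c) : entry u em c n =
      .inl (.cell (n == 0) (u n) (M.embed (u n)) (if n == 0 then some M.init else none)) := by
  have h1 : em n = false := by
    by_contra hn
    exact absurd (h.em_lt n (by simpa using hn)) (lt_irrefl _)
  rw [entry, if_neg (by simp [h1]), h.tape n le_rfl]
  by_cases hn : n = 0
  · subst hn
    simp [h.init rfl, initCfg]
  · have := h.pos_lt hn
    simp [hn, this.ne']

theorem Faithful.grow {u : ℕ → T} {n : ℕ} {em : ℕ → Bool} {c : M.Cfg}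
    (h : Faithful u n em c) : Faithful u (n + 1) em c where
  init := by simp
  pos_lt _ := by
    by_cases hn : n = 0
    · simp [h.init hn, initCfg]
    · have := h.pos_lt hn
      omega
  em_pos := h.em_pos
  em_lt i hi := (h.em_lt i hi).trans (Nat.lt_succ_self n)
  tape i hi := h.tape i (by omega)

theorem Faithful.ruleStep_grow {u : ℕ → T} {n : ℕ} {em : ℕ → Bool} {c : M.Cfg}
    (h : Faithful u n em c) : M.RuleStep none (form u n em c) (form u (n + 1) em c) := by
  refine ⟨_, _, (List.range n).map (entry u em c), [], Rule.grow (n == 0) (u n), ?_, ?_⟩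
  · simp [form]
  · rw [form_succ, h.entry_last]
    simp

theorem ruleStep_emit {u : ℕ → T} {n i : ℕ} {em : ℕ → Bool} {c : M.Cfg} (hi : i < n)
    (hem : em i = false) (hpos : i ≠ c.pos) :
    M.RuleStep none (form u n em c) (form u n (Function.update em i true) c) := by
  obtain ⟨x, y, h1, h2⟩ := replace_one_iff.2
    ⟨i, show (form u n em c)[i]? = some (.inl (.cell (i == 0) (u i) (c.tape i) none)) by
      simp [getElem?_form, entry, hi, hem, hpos],
    show ∀ j, (form u n (Function.update em i true) c)[j]? =
      if j = i then some (.inr (u i)) else (form u n em c)[j]? by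
      intro j
      simp only [getElem?_form, entry, Function.update_apply]
      grind⟩
  exact ⟨_, _, x, y, Rule.emit _ _ _, h1, h2⟩

theorem ruleStep_of_cfgStep {u : ℕ → T} {n : ℕ} {em : ℕ → Bool} {c c' : M.Cfg}
    (h : M.CfgStep c c') (hn : c.pos < n) (hn' : c'.pos < n) (hem : em c.pos = false)
    (hem' : em c'.pos = false) : M.RuleStep (some c.q) (form u n em c) (form u n em c') := by
  obtain ⟨q, t, i⟩ := c
  obtain ⟨q', t', i'⟩ := c'
  obtain ⟨g, m, ht, rfl, rfl⟩ := h
  dsimp only at *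
  have hone : moveHead m i = i → ∃ x y,
      form u n em ⟨q, t, i⟩ = x ++ [.inl (.cell (i == 0) (u i) (t i) (some q))] ++ y ∧
      form u n em ⟨q', Function.update t i g, moveHead m i⟩ =
        x ++ [.inl (.cell (i == 0) (u i) g (some q'))] ++ y := by
    intro hm
    refine replace_one_iff.2 ⟨i, by simp [getElem?_form, entry, hn, hem], fun j => ?_⟩
    simp only [getElem?_form, entry, Function.update_apply]
    grind
  cases m with
  | L =>
    rcases i with _ | i
    · obtain ⟨x, y, h1, h2⟩ := hone rfl
      exact ⟨_, _, x, y, Rule.leftFirst _ _ _ _ _ ht, h1, h2⟩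
    · clear hone
      simp only [moveHead, Nat.add_sub_cancel] at hn' hem' ⊢
      obtain ⟨x, y, h1, h2⟩ := replace_two_iff.2
        ⟨i, show (form u n em ⟨q, t, i + 1⟩)[i]? = some (.inl (.cell (i == 0) (u i) (t i) none)) by
          simp [getElem?_form, entry, hn', hem'],
        show (form u n em ⟨q, t, i + 1⟩)[i + 1]? =
            some (.inl (.cell false (u (i + 1)) (t (i + 1)) (some q))) by
          simp [getElem?_form, entry, hn, hem],
        show ∀ j, (form u n em ⟨q', Function.update t (i + 1) g, i⟩)[j]? =
            if j = i then some (.inl (.cell (i == 0) (u i) (t i) (some q')))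
            else if j = i + 1 then some (.inl (.cell false (u (i + 1)) g none))
            else (form u n em ⟨q, t, i + 1⟩)[j]? by
          intro j
          rcases eq_or_ne j (i + 1) with rfl | hj
          · simp [getElem?_form, entry, hn, hem]
          simp only [getElem?_form, entry, Function.update_apply]
          grind⟩
      exact ⟨_, _, x, y, Rule.left _ _ _ _ _ _ _ _ _ ht, h1, h2⟩
  | R =>
    clear hone
    simp only [moveHead] at hn' hem' ⊢
    obtain ⟨x, y, h1, h2⟩ := replace_two_iff.2
      ⟨i, show (form u n em ⟨q, t, i⟩)[i]? = some (.inl (.cell (i == 0) (u i) (t i) (some q))) by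
        simp [getElem?_form, entry, hn, hem],
      show (form u n em ⟨q, t, i⟩)[i + 1]? =
          some (.inl (.cell false (u (i + 1)) (t (i + 1)) none)) by
        simp [getElem?_form, entry, hn', hem'],
      show ∀ j, (form u n em ⟨q', Function.update t i g, i + 1⟩)[j]? =
          if j = i then some (.inl (.cell (i == 0) (u i) g none))
          else if j = i + 1 then some (.inl (.cell false (u (i + 1)) (t (i + 1)) (some q')))
          else (form u n em ⟨q, t, i⟩)[j]? by
        intro j
        rcases eq_or_ne j (i + 1) with rfl | hj
        · simp [getElem?_form, entry, hn', hem']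
        simp only [getElem?_form, entry, Function.update_apply]
        grind⟩
    exact ⟨_, _, x, y, Rule.right _ _ _ _ _ _ _ _ _ ht, h1, h2⟩
  | S =>
    obtain ⟨x, y, h1, h2⟩ := hone rfl
    exact ⟨_, _, x, y, Rule.stay _ _ _ _ _ _ ht, h1, h2⟩

theorem Faithful.cfgStep {u : ℕ → T} {n : ℕ} {em : ℕ → Bool} {c c' : M.Cfg}
    (h : Faithful u n em c) (hn : c.pos < n) (hstep : M.CfgStep c c') (hn' : c'.pos < n)
    (hem' : em c'.pos = false) : Faithful u n em c' := by
  refine ⟨fun h0 => by omega, fun _ => hn', hem', h.em_lt, fun i hi => ?_⟩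
  obtain ⟨g, m, -, htape, -⟩ := hstep
  rw [htape, Function.update_of_ne (by omega)]
  exact h.tape i hi

/-- Every rewriting step from a faithful description leads to a faithful description. -/
theorem Faithful.of_ruleStep {u : ℕ → T} {n : ℕ} {em : ℕ → Bool} {c : M.Cfg}
    (h : Faithful u n em c) {l : Option M.Q} {s' : List (M.CellSym ⊕ T)}
    (hs : M.RuleStep l (form u n em c) s')
    (hu : ∀ i X a, s'[i]? = some X → M.letter X = some a → a = u i) :
    ∃ n' em' c', s' = form u n' em' c' ∧ Faithful u n' em' c' ∧
      ((l = none ∧ c' = c) ∨ (l = some c.q ∧ M.CfgStep c c')) := by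
  obtain ⟨α, β, x, y, hr, hs, hs'⟩ := hs
  have hone : ∀ {A B : M.CellSym ⊕ T}, form u n em c = x ++ [A] ++ y → s' = x ++ [B] ++ y → _ :=
    fun {A B} h1 h2 => replace_one_iff.1 ⟨x, y, h1, h2⟩
  have htwo : ∀ {A A' B B' : M.CellSym ⊕ T}, form u n em c = x ++ [A, A'] ++ y →
      s' = x ++ [B, B'] ++ y → _ := fun {A A' B B'} h1 h2 => replace_two_iff.1 ⟨x, y, h1, h2⟩
  cases hr with
  | grow z a =>
    subst hs'
    have h1 : (form u n em c)[x.length]? = some (.inl (.endm z)) := by rw [hs]; simp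
    rw [getElem?_form] at h1
    have hx : x.length = n := by
      simp only [entry] at h1
      grind
    have hlen := congrArg List.length hs
    simp [form] at hlen
    obtain rfl : y = [] := List.eq_nil_of_length_eq_zero (by omega)
    rw [form, List.append_nil] at hs
    obtain ⟨rfl, h2⟩ := List.append_inj' hs rfl
    obtain rfl : z = (n == 0) := by simpa using h2.symm
    obtain rfl : a = u n := by
      refine hu n (.inl (.cell (n == 0) a (M.embed a) (if n == 0 then some M.init else none))) a
        ?_ rfl
      simp
    refine ⟨n + 1, em, c, ?_, h.grow, .inl ⟨rfl, rfl⟩⟩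
    rw [form_succ, h.entry_last]
    simp
  | emit f a g =>
    obtain ⟨i, hi, hj⟩ := hone hs hs'
    rw [getElem?_form] at hi
    obtain ⟨hx, h2, h3, h4⟩ : i < n ∧ em i = false ∧ i ≠ c.pos ∧ a = u i := by
      simp only [entry] at hi
      grind
    refine ⟨n, Function.update em i true, c, ?_, ⟨h.init, h.pos_lt, ?_, ?_, h.tape⟩,
      .inl ⟨rfl, rfl⟩⟩
    · refine List.ext_getElem? fun j => ?_
      rw [hj, getElem?_form, getElem?_form]
      simp only [entry, Function.update_apply]
      grind
    · simp [h3.symm, h.em_pos]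
    · intro i
      simp only [Function.update_apply]
      have := h.em_lt i
      grind
  | stay f a g q g' q' ht =>
    obtain ⟨i, hi, hj⟩ := hone hs hs'
    rw [getElem?_form] at hi
    obtain ⟨hx, rfl, h2, rfl, rfl, rfl, rfl⟩ : i < n ∧ i = c.pos ∧ em i = false ∧ a = u i ∧
        q = c.q ∧ g = c.tape i ∧ f = (i == 0) := by
      simp only [entry] at hi
      grind
    have hstep : M.CfgStep c ⟨q', Function.update c.tape c.pos g', c.pos⟩ :=
      ⟨g', .S, ht, rfl, rfl⟩
    refine ⟨n, em, _, ?_, h.cfgStep hx hstep hx h2, .inr ⟨rfl, hstep⟩⟩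
    refine List.ext_getElem? fun j => ?_
    rw [hj, getElem?_form, getElem?_form]
    simp only [entry, Function.update_apply]
    grind
  | leftFirst a g q g' q' ht =>
    obtain ⟨i, hi, hj⟩ := hone hs hs'
    rw [getElem?_form] at hi
    obtain ⟨hx, rfl, h2, rfl, rfl, rfl, h3⟩ : i < n ∧ i = c.pos ∧ em i = false ∧ a = u i ∧
        q = c.q ∧ g = c.tape i ∧ i = 0 := by
      simp only [entry] at hi
      grind
    have hstep : M.CfgStep c ⟨q', Function.update c.tape c.pos g', c.pos⟩ :=
      ⟨g', .L, ht, rfl, by simp [moveHead, h3]⟩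
    refine ⟨n, em, _, ?_, h.cfgStep hx hstep hx h2, .inr ⟨rfl, hstep⟩⟩
    refine List.ext_getElem? fun j => ?_
    rw [hj, getElem?_form, getElem?_form]
    simp only [entry, Function.update_apply]
    grind
  | right f a g q g' q' f₁ a₁ g₁ ht =>
    obtain ⟨i, hi, hi', hj⟩ := htwo hs hs'
    rw [getElem?_form] at hi hi'
    obtain ⟨hx, rfl, h2, rfl, rfl, rfl, rfl⟩ : i < n ∧ i = c.pos ∧ em i = false ∧ a = u i ∧
        q = c.q ∧ g = c.tape i ∧ f = (i == 0) := by
      simp only [entry] at hi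
      grind
    obtain ⟨hx', h2', rfl, rfl, rfl⟩ : c.pos + 1 < n ∧ em (c.pos + 1) = false ∧
        a₁ = u (c.pos + 1) ∧ g₁ = c.tape (c.pos + 1) ∧ f₁ = (c.pos + 1 == 0) := by
      simp only [entry] at hi'
      grind
    have hstep : M.CfgStep c ⟨q', Function.update c.tape c.pos g', c.pos + 1⟩ :=
      ⟨g', .R, ht, rfl, rfl⟩
    refine ⟨n, em, _, ?_, h.cfgStep hx hstep hx' h2', .inr ⟨rfl, hstep⟩⟩
    refine List.ext_getElem? fun j => ?_
    rw [hj, getElem?_form, getElem?_form]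
    clear hone htwo hs hs' hu hj hi hi'
    rcases eq_or_ne j (c.pos + 1) with rfl | hj
    · simp [entry, hx', h2']
    simp only [entry, Function.update_apply]
    grind
  | left f a g q g' q' f₁ a₁ g₁ ht =>
    obtain ⟨i, hi, hi', hj⟩ := htwo hs hs'
    rw [getElem?_form] at hi hi'
    obtain ⟨hx, hpos, h2, rfl, rfl, rfl, rfl⟩ : i + 1 < n ∧ c.pos = i + 1 ∧ em (i + 1) = false ∧
        a = u (i + 1) ∧ q = c.q ∧ g = c.tape (i + 1) ∧ f = (i + 1 == 0) := by
      simp only [entry] at hi'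
      grind
    obtain ⟨hx', h2', rfl, rfl, rfl⟩ : i < n ∧ em i = false ∧
        a₁ = u i ∧ g₁ = c.tape i ∧ f₁ = (i == 0) := by
      simp only [entry] at hi
      grind
    have hstep : M.CfgStep c ⟨q', Function.update c.tape c.pos g', i⟩ :=
      ⟨g', .L, by rwa [hpos], rfl, by simp [moveHead, hpos]⟩
    refine ⟨n, em, _, ?_, h.cfgStep (by omega) hstep hx' h2', .inr ⟨rfl, hstep⟩⟩
    refine List.ext_getElem? fun j => ?_
    rw [hj, getElem?_form, getElem?_form]
    clear hone htwo hs hs' hu hj hi hi'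
    rcases eq_or_ne j (i + 1) with rfl | hj
    · simp [entry, hx, h2, hpos]
    simp only [entry, Function.update_apply, hpos]
    grind

end OmegaTM
namespace OmegaTM

variable {T : Type} {M : OmegaTM T}

/-- In a derivation generating `u`, the letters carried by the symbols are those of `u`. -/
theorem letter_eq_of_ruleStep {u : ℕ → T} {s : ℕ → List (M.CellSym ⊕ T)} {l : ℕ → Option M.Q}
    (h0 : s 0 = [.inl (.endm true)]) (hstep : ∀ i, M.RuleStep (l i) (s i) (s (i + 1)))
    (hunb : ∀ n, ∃ i, n ≤ (termPrefix (s i)).length)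
    (hu : ∀ i, MatchesPrefix (termPrefix (s i)) u) (i m : ℕ) (X : M.CellSym ⊕ T) (a : T)
    (hX : (s i)[m]? = some X) (ha : M.letter X = some a) : a = u m := by
  have hL : ∀ i, ∃ L : List T, (s i).map M.letter = L.map some ++ [none] := by
    intro i
    induction i with
    | zero => exact ⟨[], by simp [h0, letter]⟩
    | succ i ih =>
      obtain ⟨L, hL⟩ := ih
      obtain ⟨L', -, hL'⟩ := (hstep i).letters hL
      exact ⟨L', hL'⟩
  choose L hL using hL
  have hsucc : ∀ i, L i <+: L (i + 1) := by
    intro i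
    obtain ⟨L', h1, h2⟩ := (hstep i).letters (hL i)
    rw [hL] at h2
    have : L (i + 1) = L' := List.map_injective_iff.2 (Option.some_injective T)
      (List.append_cancel_right h2)
    rwa [this]
  have hmono : ∀ {i j}, i ≤ j → L i <+: L j := by
    intro i j hij
    induction hij with
    | refl => exact List.prefix_rfl
    | step _ ih => exact ih.trans (hsucc _)
  have hget : ∀ {i m : ℕ} {X a}, (s i)[m]? = some X → M.letter X = some a → (L i)[m]? = some a := by
    intro i m X a hX ha
    have h1 : ((s i).map M.letter)[m]? = some (some a) := by simp [hX, ha]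
    rw [hL, List.getElem?_append] at h1
    split_ifs at h1
    · simpa using h1
    · simp [List.getElem?_singleton] at h1
  obtain ⟨j, hj⟩ := hunb (m + 1)
  have h1 := hget (getElem?_of_lt_termPrefix (Nat.lt_of_succ_le hj)) rfl
  have h2 := hget hX ha
  have h3 := hu j m (Nat.lt_of_succ_le hj)
  rw [List.get_eq_getElem] at h3
  rw [h3] at h1
  have hpre : ∀ {k a}, k ≤ max i j → (L k)[m]? = some a → (L (max i j))[m]? = some a := by
    intro k a hk h
    obtain ⟨t, ht⟩ := hmono hk
    rw [← ht, List.getElem?_append_left (List.getElem?_eq_some_iff.1 h).1, h]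
  have h4 := hpre (le_max_left i j) h2
  have h5 := hpre (le_max_right i j) h1
  rw [h4] at h5
  exact Option.some_injective _ h5

theorem Faithful.length_termPrefix_form_le {u : ℕ → T} {n : ℕ} {em : ℕ → Bool} {c : M.Cfg}
    (h : Faithful u n em c) : (termPrefix (form u n em c)).length ≤ c.pos := by
  by_cases hn : n = 0
  · subst hn
    exact length_termPrefix_le (A := .endm true) (by simp [form, h.init rfl, initCfg])
  · exact length_termPrefix_le (by
      rw [getElem?_form, if_pos (h.pos_lt hn), entry, if_neg (by simp [h.em_pos])])

theorem lang_toGrammar_subset [Finite T] (σ : AccSigma) (ρ : AccRho) :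
    (M.toGrammar ρ).Lang σ ρ .nl ⊆ M.Lang σ ρ := by
  rintro u ⟨s, d, h0, hstep, hunb, hu, hacc⟩
  change ℕ → List (M.CellSym ⊕ T) at s
  change ℕ → M.RuleType at d
  have hrule : ∀ i, M.RuleStep (d i).1.2.2 (s i) (s (i + 1)) := fun i =>
    (M.exists_step_iff).1 ⟨d i, hstep i, rfl⟩
  have hletter := letter_eq_of_ruleStep h0 hrule hunb hu
  obtain ⟨f, hf0, hf, hfstep⟩ := exists_seq_of_forall_exists
    (P := fun x : ℕ × ℕ × (ℕ → Bool) × M.Cfg =>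
      s x.1 = form u x.2.1 x.2.2.1 x.2.2.2 ∧ Faithful u x.2.1 x.2.2.1 x.2.2.2)
    (R := fun x y => y.1 = x.1 + 1 ∧
      (((d x.1).1.2.2 = none ∧ y.2.2.2 = x.2.2.2) ∨
        ((d x.1).1.2.2 = some x.2.2.2.q ∧ M.CfgStep x.2.2.2 y.2.2.2)))
    (x₀ := (0, 0, fun _ => false, M.initCfg u))
    ⟨h0, fun _ => rfl, fun h => absurd rfl h, rfl, by simp, fun i _ => rfl⟩ (by
      rintro ⟨i, n, em, c⟩ ⟨hs, hF⟩
      dsimp only at hs hF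
      obtain ⟨n', em', c', h1, h2, h3⟩ := hF.of_ruleStep (hs ▸ hrule i) (hletter (i + 1))
      exact ⟨(i + 1, n', em', c'), ⟨h1, h2⟩, rfl, h3⟩)
  have hi : ∀ i, (f i).1 = i := by
    intro i
    induction i with
    | zero => rw [hf0]
    | succ i ih => rw [(hfstep i).1, ih]
  have htp : ∀ i, (termPrefix (s i)).length ≤ (f i).2.2.2.pos := by
    intro i
    have := (hf i).1
    rw [hi] at this
    rw [this]
    exact (hf i).2.length_termPrefix_form_le
  have hmono : Monotone fun i => (termPrefix (s i)).length :=
    monotone_nat_of_le_succ fun i => (hstep i).termPrefix_isPrefix.length_le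
  have hpos : ∀ n, ∃ i₀, ∀ i, i₀ ≤ i → n < (f i).2.2.2.pos := by
    intro n
    obtain ⟨i₀, h⟩ := hunb (n + 1)
    exact ⟨i₀, fun i hi => lt_of_lt_of_le h ((hmono hi).trans (htp i))⟩
  have hlab : ∀ i, ((d i).1.2.2 = none ∧ (f (i + 1)).2.2.2 = (f i).2.2.2) ∨
      ((d i).1.2.2 = some (f i).2.2.2.q ∧ M.CfgStep (f i).2.2.2 (f (i + 1)).2.2.2) := by
    intro i
    have := (hfstep i).2
    rwa [hi] at this
  have hnone : ∀ i, (d i).1.2.2 = none → (f (i + 1)).2.2.2 = (f i).2.2.2 := by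
    intro i h
    rcases hlab i with h1 | h1
    · exact h1.2
    · simp [h] at h1
  obtain ⟨D, e, cnt, hst, hD⟩ := exists_stutter (fun i => (f i).2.2.2) (fun i => (d i).1.2.2)
    hnone (by
      intro n
      by_contra hcon
      push Not at hcon
      have hconst : ∀ i, n ≤ i → (f i).2.2.2 = (f n).2.2.2 := by
        intro i hi
        induction i, hi using Nat.le_induction with
        | base => rfl
        | succ i hi ih => rw [hnone i (hcon i hi), ih]
      obtain ⟨i₀, h⟩ := hpos (f n).2.2.2.pos
      have := h _ (le_max_left i₀ n)
      rw [hconst _ (le_max_right i₀ n)] at this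
      exact lt_irrefl _ this)
  have hact : ∀ k, e k = (D k).q ∧ M.CfgStep (D k) (D (k + 1)) := by
    intro k
    obtain ⟨i, hk, hl, hk'⟩ := hst.exists_active k
    have h1 := hD i
    have h2 := hD (i + 1)
    rw [hk] at h1
    rw [hk'] at h2
    rw [← h1, ← h2]
    rcases hlab i with h | h
    · simp [hl] at h
    · exact ⟨by simpa [hl] using h.1, h.2⟩
  refine M.mem_lang_iff.2 ⟨D, ?_, fun k => (hact k).2, fun n => ?_, ?_⟩
  · have := hD 0
    rw [hst.zero, hf0] at this
    exact this.symm
  · obtain ⟨i₀, h⟩ := hpos n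
    refine ⟨cnt i₀, fun k hk => ?_⟩
    obtain ⟨i, hik, -, -⟩ := hst.exists_active k
    rcases le_total i₀ i with hle | hle
    · have := hD i
      rw [hik] at this
      rw [← this]
      exact h i hle
    · have := hst.mono hle
      have := hD i₀
      rw [show cnt i₀ = k by omega] at this
      rw [← this]
      exact h i₀ le_rfl
  · have : (fun i => (D i).q) = e := funext fun k => (hact k).1.symm
    rw [this]
    exact (Stutter.isAccepting_iff (X := M.RuleType) (l := fun p => p.1.2.2) hst σ ρ M.acc).1 hacc

end OmegaTM
namespace OmegaTM

variable {T : Type} {M : OmegaTM T}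

theorem matchesPrefix_termPrefix_form (u : ℕ → T) (n : ℕ) (em : ℕ → Bool) (c : M.Cfg) :
    MatchesPrefix (termPrefix (form u n em c)) u := by
  intro k hk
  have h := getElem?_of_lt_termPrefix hk
  rw [getElem?_form] at h
  simp only [entry] at h
  rw [List.get_eq_getElem]
  grind

theorem CfgStep.pos_le {c c' : M.Cfg} (h : M.CfgStep c c') : c'.pos ≤ c.pos + 1 := by
  obtain ⟨-, m, -, -, h⟩ := h
  rw [h]
  cases m <;> simp only [moveHead] <;> omega

theorem lang_subset_toGrammar [Finite T] (σ : AccSigma) (ρ : AccRho) :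
    M.Lang σ ρ ⊆ (M.toGrammar ρ).Lang σ ρ .nl := by
  intro u hu
  obtain ⟨D, h0, hstep, hpos, hacc⟩ := M.mem_lang_iff.1 hu
  let em : ℕ → ℕ → Bool := fun b j => decide (j < b)
  have hem : ∀ b, Function.update (em b) b true = em (b + 1) := by
    intro b
    funext j
    simp only [em, Function.update_apply]
    grind
  obtain ⟨f, hf0, hf, hfstep⟩ := exists_seq_of_forall_exists
    (P := fun x : ℕ × ℕ × ℕ => Faithful u x.2.1 (em x.2.2) (D x.1) ∧
      ∀ j, x.1 ≤ j → x.2.2 ≤ (D j).pos)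
    (R := fun x y => ∃ l, M.RuleStep l (form u x.2.1 (em x.2.2) (D x.1))
        (form u y.2.1 (em y.2.2) (D y.1)) ∧
      ((l = none ∧ y.1 = x.1 ∧ ((D y.1).pos + 2 - y.2.1) + ((D y.1).pos - y.2.2) <
          ((D x.1).pos + 2 - x.2.1) + ((D x.1).pos - x.2.2)) ∨
        (l = some (D x.1).q ∧ y.1 = x.1 + 1 ∧ ∃ j, x.1 ≤ j ∧ (D j).pos ≤ x.2.2)))
    (x₀ := (0, 0, 0))
    ⟨⟨fun _ => h0, fun h => absurd rfl h, by simp [em], by simp [em], fun i _ => by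
      simp [h0, initCfg]⟩, by simp⟩ (by
      rintro ⟨k, n, b⟩ ⟨hF, hb⟩
      dsimp only at hF hb
      by_cases hn : n < (D k).pos + 2
      · refine ⟨(k, n + 1, b), ⟨hF.grow, hb⟩, none, hF.ruleStep_grow, .inl ⟨rfl, rfl, ?_⟩⟩
        dsimp only
        omega
      by_cases hb' : ∀ j, k ≤ j → b < (D j).pos
      · have hbk := hb' k le_rfl
        have hs : M.RuleStep none (form u n (em b) (D k)) (form u n (em (b + 1)) (D k)) := by
          rw [← hem]
          exact ruleStep_emit (by omega) (by simp [em]) (by omega)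
        refine ⟨(k, n, b + 1), ⟨⟨hF.init, hF.pos_lt, ?_, ?_, hF.tape⟩, hb'⟩, none, hs,
          .inl ⟨rfl, rfl, ?_⟩⟩
        · simp only [em, decide_eq_false_iff_not]
          omega
        · simp only [em, decide_eq_true_eq]
          omega
        · dsimp only
          omega
      · push Not at hb'
        have hp := (hstep k).pos_le
        have hn₀ : (D k).pos < n := by omega
        have hn₁ : (D (k + 1)).pos < n := by omega
        have hem' : em b (D (k + 1)).pos = false := by
          have := hb (k + 1) (by omega)
          simp only [em, decide_eq_false_iff_not]
          omega
        exact ⟨(k + 1, n, b), ⟨hF.cfgStep hn₀ (hstep k) hn₁ hem',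
            fun j hj => hb j (by omega)⟩, some (D k).q,
          ruleStep_of_cfgStep (hstep k) hn₀ hn₁ hF.em_pos hem',
          .inr ⟨rfl, rfl, hb'⟩⟩)
  choose lab hrule hlab using hfstep
  choose d hd hdlab using fun i => M.exists_step_iff (ρ := ρ) |>.2 (hrule i)
  have hst : Stutter (fun i => (d i).1.2.2) (fun k => (D k).q) fun i => (f i).1 := by
    refine ⟨by rw [hf0], fun i => ?_, unbounded_of_measure _
      (fun i => ((D (f i).1).pos + 2 - (f i).2.1) + ((D (f i).1).pos - (f i).2.2)) fun i => ?_⟩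
    · rw [hdlab]
      rcases hlab i with ⟨h1, h2, -⟩ | ⟨h1, h2, -⟩
      · exact .inl ⟨h1, h2⟩
      · exact .inr ⟨h1, h2⟩
    · rcases hlab i with ⟨-, h1, h2⟩ | ⟨-, h1, -⟩
      · exact .inl ⟨h1, h2⟩
      · exact .inr h1
  refine ⟨fun i => form u (f i).2.1 (em (f i).2.2) (D (f i).1), d, ?_, hd, fun m => ?_,
    fun i => matchesPrefix_termPrefix_form _ _ _ _,
    (Stutter.isAccepting_iff (X := M.RuleType) (l := fun p => p.1.2.2) hst σ ρ M.acc).2 hacc⟩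
  · simp [hf0, form]
    rfl
  · obtain ⟨k, hk⟩ := hpos m
    obtain ⟨i, hik, -, hik'⟩ := hst.exists_active k
    refine ⟨i, ?_⟩
    have hm : m ≤ (f i).2.2 := by
      rcases hlab i with ⟨-, h, -⟩ | ⟨-, -, j, hj, hjb⟩
      · omega
      · have := hk j (by omega)
        omega
    refine hm.trans (le_length_termPrefix fun j hj => ⟨u j, ?_⟩)
    have hjb : em (f i).2.2 j = true := by simpa [em] using hj
    change (form u (f i).2.1 (em (f i).2.2) (D (f i).1))[j]? = _
    rw [getElem?_form, if_pos ((hf i).1.em_lt j hjb), entry, if_pos hjb]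
    rfl

theorem lang_toGrammar [Finite T] (M : OmegaTM T) (σ : AccSigma) (ρ : AccRho) :
    (M.toGrammar ρ).Lang σ ρ .nl = M.Lang σ ρ :=
  (lang_toGrammar_subset σ ρ).antisymm (lang_subset_toGrammar σ ρ)

end OmegaTM

/-! ### From context-sensitive ω-grammars to Turing ω-machines -/

section Tape

variable {N T : Type} (u : ℕ → T)

/-- The tape holding the input `u` on its first track, the sentential form `l` on its second
track, and the mark `m` on its third track. -/
def enc (m : Option ℕ) (l : List (N ⊕ T)) (n : ℕ) : T × Option (N ⊕ T) × Bool :=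
  (u n, l[n]?, decide (m = some n))

/-- The first `b` letters of `u`, as a sentential form. -/
def pre (b : ℕ) : List (N ⊕ T) := ((List.range b).map u).map Sum.inr

variable {u}

@[simp]
theorem length_pre (b : ℕ) : (pre u b : List (N ⊕ T)).length = b := by simp [pre]

theorem pre_succ (b : ℕ) : (pre u (b + 1) : List (N ⊕ T)) = pre u b ++ [.inr (u b)] := by
  simp [pre, List.range_succ]

theorem termPrefix_pre_append (b : ℕ) (s : List (N ⊕ T)) :
    termPrefix (pre u b ++ s) = (List.range b).map u ++ termPrefix s :=
  termPrefix_map_inr_append _ _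

theorem update_enc_cons {m : Option ℕ} (z v : List (N ⊕ T)) (X Y : N ⊕ T) :
    Function.update (enc u m (z ++ X :: v)) z.length
      (u z.length, some Y, decide (m = some z.length)) = enc u m (z ++ Y :: v) := by
  funext j
  rcases eq_or_ne j z.length with rfl | hj
  · simp [enc]
  · rw [Function.update_of_ne hj]
    simp only [enc, List.getElem?_append, List.getElem?_cons]
    grind

theorem update_enc_length {m : Option ℕ} (z : List (N ⊕ T)) (Y : N ⊕ T) :
    Function.update (enc u m z) z.length (u z.length, some Y, decide (m = some z.length)) =
      enc u m (z ++ [Y]) := by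
  funext j
  rcases eq_or_ne j z.length with rfl | hj
  · simp [enc]
  · rw [Function.update_of_ne hj]
    simp only [enc, List.getElem?_append, List.getElem?_singleton]
    grind

theorem update_enc_mark (l : List (N ⊕ T)) (b : ℕ) :
    Function.update (enc u none l) b (u b, l[b]?, true) = enc u (some b) l := by
  funext j
  rcases eq_or_ne j b with rfl | hj
  · simp [enc]
  · simp [enc, hj, hj.symm]

theorem update_enc_unmark (l : List (N ⊕ T)) (b : ℕ) :
    Function.update (enc u (some b) l) b (u b, l[b]?, false) = enc u none l := by
  funext j
  rcases eq_or_ne j b with rfl | hj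
  · simp [enc]
  · simp [enc, hj, hj.symm]

end Tape

namespace OmegaPSG

variable {T : Type} (G : OmegaPSG T)

/-- States of the machine simulating `G`. At `home`, the head stands behind the verified terminal
prefix; a rewriting is performed in one round trip from there. -/
inductive SimState
  | init
  | home
  /-- looking for the place to rewrite -/
  | seek
  /-- replacing the left-hand side of `p`, of which `rem` is left, by `queue` -/
  | repl (p : G.P) (rem : List G.N) (queue : List (G.N ⊕ T))
  /-- the left-hand side of `p` has been found, `queue` is still to be inserted -/
  | app (p : G.P) (queue : List (G.N ⊕ T))
  /-- inserting `queue` -/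
  | shift (queue : List (G.N ⊕ T))
  /-- going back to the mark -/
  | ret

variable {G}

namespace SimState

/-- Transitions of the machine simulating `G`. -/
inductive Trans : G.SimState → T × Option (G.N ⊕ T) × Bool → G.SimState →
    T × Option (G.N ⊕ T) × Bool → Move → Prop
  | init (a) : Trans init (a, none, false) home (a, some (.inl G.start), false) .S
  | advance (a) : Trans home (a, some (.inr a), false) home (a, some (.inr a), false) .R
  | mark (a X) : Trans home (a, X, false) seek (a, X, true) .S
  | skip (a X m) : Trans seek (a, some X, m) seek (a, some X, m) .R
  | pick (p c) : Trans seek c (repl p (G.lhs p) (G.rhs p)) c .S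
  | repl (p A rem w queue a m) : Trans (repl p (A :: rem) (w :: queue)) (a, some (.inl A), m)
      (repl p rem queue) (a, some w, m) .R
  | found (p queue c) : Trans (repl p [] queue) c (app p queue) c .S
  | app (p queue c) : Trans (app p queue) c (shift queue) c .S
  | carry (w queue a Y m) : Trans (shift (w :: queue)) (a, some Y, m)
      (shift (queue ++ [Y])) (a, some w, m) .R
  | put (w queue a m) : Trans (shift (w :: queue)) (a, none, m) (shift queue) (a, some w, m) .R
  | finish (c) : Trans (shift []) c ret c .S
  | back (a X) : Trans ret (a, X, false) ret (a, X, false) .L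
  | halt (a X) : Trans ret (a, X, true) home (a, X, false) .S

/-- The production applied in a state. -/
def lab : G.SimState → Option G.P
  | app p _ => some p
  | _ => none

/-- Both lists stored in the state have length at most `B`. -/
def Valid (B : ℕ) : G.SimState → Prop
  | repl _ rem queue => rem.length ≤ B ∧ queue.length ≤ B
  | app _ queue => queue.length ≤ B
  | shift queue => queue.length ≤ B
  | _ => True

theorem finite_valid [Finite T] (B : ℕ) : {q : G.SimState | q.Valid B}.Finite := by
  have := G.fintypeN
  have := G.fintypeP
  have h : ((Set.univ : Set (Fin 7)) ×ˢ ((Set.univ : Set (Option G.P)) ×ˢ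
      ({l : List G.N | l.length ≤ B} ×ˢ {l : List (G.N ⊕ T) | l.length ≤ B}))).Finite :=
    Set.finite_univ.prod (Set.finite_univ.prod
      ((List.finite_length_le _ _).prod (List.finite_length_le _ _)))
  let code : G.SimState → Fin 7 × Option G.P × List G.N × List (G.N ⊕ T) := fun
    | init => (0, none, [], [])
    | home => (1, none, [], [])
    | seek => (2, none, [], [])
    | repl p rem queue => (3, some p, rem, queue)
    | app p queue => (4, some p, [], queue)
    | shift queue => (5, none, [], queue)
    | ret => (6, none, [], [])
  have hcode : Function.Injective code := by
    intro q q' hq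
    cases q <;> cases q' <;> simp_all [code]
  refine (h.preimage hcode.injOn).subset fun q hq => ?_
  change q.Valid B at hq
  cases q <;> simp_all [code, Valid]

/-- `Rel u q t n s`: in state `q` with tape `t` and head position `n`, the machine represents the
sentential form `s`. -/
inductive Rel (u : ℕ → T) : G.SimState → (ℕ → T × Option (G.N ⊕ T) × Bool) → ℕ →
    List (G.N ⊕ T) → Prop
  | init : Rel u init (enc u none []) 0 [.inl G.start]
  | home (b s) : Rel u home (enc u none (pre u b ++ s)) b (pre u b ++ s)
  | seek (b z v) : pre u b <+: z → Rel u seek (enc u (some b) (z ++ v)) z.length (z ++ v)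
  | repl (b z v p α rem β queue) : pre u b <+: z → G.lhs p = α ++ rem → G.rhs p = β ++ queue →
      β.length = α.length →
      Rel u (repl p rem queue) (enc u (some b) (z ++ β ++ v)) (z ++ β).length
        (z ++ α.map Sum.inl ++ v)
  | app (b z v p β queue) : pre u b <+: z → G.rhs p = β ++ queue →
      β.length = (G.lhs p).length →
      Rel u (app p queue) (enc u (some b) (z ++ β ++ v)) (z ++ β).length
        (z ++ (G.lhs p).map Sum.inl ++ v)
  | shift (b z v queue) : pre u b <+: z →
      Rel u (shift queue) (enc u (some b) (z ++ v)) z.length (z ++ queue ++ v)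
  | ret (b z v) : pre u b <+: z → Rel u ret (enc u (some b) (z ++ v)) z.length (z ++ v)

theorem Rel.step {u : ℕ → T} {q q' : G.SimState} {t : ℕ → T × Option (G.N ⊕ T) × Bool} {n : ℕ}
    {s : List (G.N ⊕ T)} {g : T × Option (G.N ⊕ T) × Bool} {m : Move} (h : Rel u q t n s)
    (ht : Trans q (t n) q' g m) :
    ∃ s', Rel u q' (Function.update t n g) (moveHead m n) s' ∧
      ((q.lab = none ∧ s' = s) ∨ ∃ p, q.lab = some p ∧ G.Step p s s') := by
  generalize hc : t n = c at ht
  cases h with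
  | init =>
    cases ht with
    | init a =>
      obtain rfl : u 0 = a := by simpa [enc] using hc
      refine ⟨_, ?_, .inl ⟨rfl, rfl⟩⟩
      have := update_enc_length (u := u) (m := none) [] (.inl G.start : G.N ⊕ T)
      simp only [List.length_nil, reduceCtorEq, decide_false, List.nil_append] at this
      rw [this]
      exact Rel.home 0 _
  | home _ s =>
    cases ht with
    | advance a =>
      rw [← hc, Function.update_eq_self]
      refine ⟨_, ?_, .inl ⟨rfl, rfl⟩⟩
      simp only [enc, Prod.mk.injEq, List.getElem?_append_right (length_pre n).le, length_pre,
        Nat.sub_self] at hc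
      obtain ⟨rfl, h1, -⟩ := hc
      rcases s with _ | ⟨X, s⟩
      · simp at h1
      · obtain rfl : X = _ := by simpa using h1
        have := Rel.home (G := G) (u := u) (n + 1) s
        rwa [pre_succ, List.append_assoc, List.singleton_append] at this
    | mark a X =>
      simp only [enc, Prod.mk.injEq] at hc
      obtain ⟨rfl, rfl, -⟩ := hc
      rw [update_enc_mark]
      refine ⟨_, ?_, .inl ⟨rfl, rfl⟩⟩
      have := Rel.seek (G := G) (u := u) n (pre u n) s List.prefix_rfl
      rwa [length_pre] at this
  | seek b z v hz =>
    cases ht with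
    | skip a X m =>
      rw [← hc, Function.update_eq_self]
      refine ⟨_, ?_, .inl ⟨rfl, rfl⟩⟩
      simp only [enc, Prod.mk.injEq] at hc
      rcases v with _ | ⟨X, v⟩
      · simp at hc
      · have := Rel.seek (G := G) (u := u) b (z ++ [X]) v (hz.trans (List.prefix_append _ _))
        simpa [moveHead] using this
    | pick p c =>
      rw [← hc, Function.update_eq_self]
      refine ⟨_, ?_, .inl ⟨rfl, rfl⟩⟩
      simpa [moveHead] using Rel.repl (u := u) b z v p [] _ [] _ hz rfl rfl rfl
  | repl b z v p α rem β queue hz h1 h2 h3 =>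
    cases ht with
    | repl _ A rem w queue a m =>
      simp only [enc, Prod.mk.injEq] at hc
      obtain ⟨rfl, hX, rfl⟩ := hc
      rcases v with _ | ⟨X, v⟩
      · simp at hX
      · obtain rfl : X = _ := by simpa using hX
        rw [update_enc_cons]
        refine ⟨_, ?_, .inl ⟨rfl, rfl⟩⟩
        have := Rel.repl (u := u) b z v p (α ++ [A]) rem (β ++ [w]) queue hz (by simp [h1])
          (by simp [h2]) (by simp [h3])
        simpa [moveHead, add_assoc] using this
    | found _ queue c =>
      rw [← hc, Function.update_eq_self]
      refine ⟨_, ?_, .inl ⟨rfl, rfl⟩⟩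
      have := Rel.app (u := u) b z v p β queue hz h2 (by simp [h1, h3])
      rw [h1, List.append_nil] at this
      exact this
  | app b z v p β queue hz h2 h3 =>
    cases ht with
    | app _ _ c =>
      rw [← hc, Function.update_eq_self]
      refine ⟨_, Rel.shift b (z ++ β) v queue (hz.trans (List.prefix_append _ _)),
        .inr ⟨p, rfl, z, v, rfl, by simp [h2]⟩⟩
  | shift b z v queue hz =>
    cases ht with
    | carry w queue a Y m =>
      simp only [enc, Prod.mk.injEq] at hc
      obtain ⟨rfl, h3, rfl⟩ := hc
      rcases v with _ | ⟨X, v⟩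
      · simp at h3
      · obtain rfl : X = _ := by simpa using h3
        rw [update_enc_cons]
        refine ⟨_, ?_, .inl ⟨rfl, rfl⟩⟩
        have := Rel.shift (G := G) (u := u) b (z ++ [w]) v (queue ++ [X])
          (hz.trans (List.prefix_append _ _))
        simpa [moveHead] using this
    | put w queue a m =>
      simp only [enc, Prod.mk.injEq] at hc
      obtain ⟨rfl, h3, rfl⟩ := hc
      rcases v with _ | ⟨X, v⟩
      · rw [List.append_nil, update_enc_length]
        refine ⟨_, ?_, .inl ⟨rfl, rfl⟩⟩
        have := Rel.shift (G := G) (u := u) b (z ++ [w]) [] queue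
          (hz.trans (List.prefix_append _ _))
        simpa [moveHead] using this
      · simp at h3
    | finish c =>
      rw [← hc, Function.update_eq_self]
      refine ⟨_, ?_, .inl ⟨rfl, rfl⟩⟩
      simpa [moveHead] using Rel.ret (G := G) (u := u) b z v hz
  | ret b z v hz =>
    cases ht with
    | back a X =>
      rw [← hc, Function.update_eq_self]
      refine ⟨_, ?_, .inl ⟨rfl, rfl⟩⟩
      simp only [enc, Prod.mk.injEq, decide_eq_false_iff_not, Option.some.injEq] at hc
      have hlen := hz.length_le
      rw [length_pre] at hlen
      rcases List.eq_nil_or_concat z with rfl | ⟨z, Y, rfl⟩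
      · simp at hlen hc
        exact absurd hlen hc.2.2
      · simp only [List.concat_eq_append, List.length_append, List.length_singleton] at hlen hc hz
        have := Rel.ret (G := G) (u := u) b z (Y :: v) (List.prefix_of_prefix_length_le hz
          (List.prefix_append _ _) (by rw [length_pre]; omega))
        simpa [moveHead] using this
    | halt a X =>
      simp only [enc, Prod.mk.injEq, decide_eq_true_eq, Option.some.injEq] at hc
      obtain ⟨rfl, rfl, hb⟩ := hc
      obtain rfl : pre u b = z := hz.eq_of_length (by simp [hb])
      refine ⟨_, ?_, .inl ⟨rfl, rfl⟩⟩
      simp only [length_pre, moveHead]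
      rw [update_enc_unmark]
      exact Rel.home b v

end SimState
end OmegaPSG
namespace OmegaPSG

variable {T : Type} (G : OmegaPSG T)

/-- A bound for the lengths of the sides of all productions. -/
def bound : ℕ :=
  letI := G.fintypeP
  ∑ p, ((G.lhs p).length + (G.rhs p).length)

theorem length_add_length_le_bound (p : G.P) :
    (G.lhs p).length + (G.rhs p).length ≤ G.bound :=
  letI := G.fintypeP
  Finset.single_le_sum (f := fun p => (G.lhs p).length + (G.rhs p).length)
    (fun _ _ => Nat.zero_le _) (Finset.mem_univ p)

instance [Finite T] : Finite {q : G.SimState // q.Valid G.bound} :=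
  (SimState.finite_valid G.bound).to_subtype

/-- The Turing ω-machine simulating `G`. -/
noncomputable def toTM [Finite T] (ρ : AccRho) : OmegaTM T where
  Q := {q : G.SimState // q.Valid G.bound}
  fintypeQ := Fintype.ofFinite _
  Γ := T × Option (G.N ⊕ T) × Bool
  fintypeΓ :=
    haveI := G.fintypeN
    Fintype.ofFinite _
  embed a := (a, none, false)
  embed_inj := fun _ _ h => congrArg Prod.fst h
  init := ⟨.init, trivial⟩
  trans q g q' g' m := SimState.Trans q.1 g q'.1 g' m
  acc := liftAcc (fun q => q.1.lab) G.acc ρ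

variable {G}

theorem initCfg_toTM [Finite T] (ρ : AccRho) (u : ℕ → T) :
    (G.toTM ρ).initCfg u = ⟨⟨.init, trivial⟩, enc u none [], 0⟩ := by
  have h : (enc u none [] : ℕ → T × Option (G.N ⊕ T) × Bool) = fun n => (u n, none, false) := by
    funext n
    simp [enc]
  rw [h]
  rfl

namespace SimState

variable {u : ℕ → T} {q q' : G.SimState} {t : ℕ → T × Option (G.N ⊕ T) × Bool} {n : ℕ}
  {s : List (G.N ⊕ T)}

theorem Rel.le_length (h : Rel u q t n s) : n ≤ s.length := by
  cases h with
  | repl b z v p α rem β queue hz h1 h2 h3 => simp; omega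
  | app b z v p β queue hz h2 h3 => simp; omega
  | _ => simp

theorem Rel.pre_isPrefix (h : Rel u .home t n s) : pre u n <+: s := by
  cases h
  exact List.prefix_append _ _

/-- The progress of a round trip of the head. -/
def phase : G.SimState → ℕ
  | seek => 1
  | repl _ _ _ => 2
  | app _ _ => 3
  | shift _ => 4
  | ret => 5
  | _ => 0

theorem Trans.phase_le {c c' : T × Option (G.N ⊕ T) × Bool} {m : Move} (h : Trans q c q' c' m)
    (hq' : q' ≠ home) : q.phase ≤ q'.phase ∧ (q.lab ≠ none → q.phase = 3 ∧ q'.phase = 4) := by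
  cases h <;> simp_all [phase, lab]

end SimState

theorem lang_toTM_subset [Finite T] (σ : AccSigma) (ρ : AccRho) :
    (G.toTM ρ).Lang σ ρ ⊆ G.Lang σ ρ .nl := by
  intro u hu
  obtain ⟨D, h0, hstep, hpos, hacc⟩ := (G.toTM ρ).mem_lang_iff.1 hu
  let q : ℕ → {q : G.SimState // q.Valid G.bound} := fun i => (D i).q
  obtain ⟨f, hf0, hf, hfstep⟩ := exists_seq_of_forall_exists
    (P := fun x : ℕ × List (G.N ⊕ T) =>
      SimState.Rel u (q x.1).1 (D x.1).tape (D x.1).pos x.2)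
    (R := fun x y => y.1 = x.1 + 1 ∧ (((q x.1).1.lab = none ∧ y.2 = x.2) ∨
      ∃ p, (q x.1).1.lab = some p ∧ G.Step p x.2 y.2))
    (x₀ := (0, [.inl G.start])) (by
      dsimp only [q]
      rw [h0, initCfg_toTM]
      exact SimState.Rel.init) (by
      rintro ⟨i, s⟩ hs
      obtain ⟨g, m, ht, h1, h2⟩ := hstep i
      obtain ⟨s', hs', h⟩ := hs.step (q' := (q (i + 1)).1) ht
      refine ⟨(i + 1, s'), ?_, rfl, h⟩
      dsimp only
      rw [h1, h2]
      exact hs')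
  have hi : ∀ i, (f i).1 = i := by
    intro i
    induction i with
    | zero => rw [hf0]
    | succ i ih => rw [(hfstep i).1, ih]
  replace hf : ∀ i, SimState.Rel u (q i).1 (D i).tape (D i).pos (f i).2 := fun i => by
    have := hf i
    rwa [hi] at this
  replace hfstep : ∀ i, ((q i).1.lab = none ∧ (f (i + 1)).2 = (f i).2) ∨
      ∃ p, (q i).1.lab = some p ∧ G.Step p (f i).2 (f (i + 1)).2 := fun i => by
    have := (hfstep i).2
    rwa [hi] at this
  have hnone : ∀ i, (q i).1.lab = none → (f (i + 1)).2 = (f i).2 := by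
    intro i h
    rcases hfstep i with h1 | ⟨p, h1, -⟩
    · exact h1.2
    · simp [h] at h1
  have hinf : ∀ n, ∃ i, n ≤ i ∧ (q i).1.lab ≠ none := by
    intro n
    by_contra hcon
    push Not at hcon
    have hconst : ∀ i, n ≤ i → (f i).2 = (f n).2 := by
      intro i hi
      induction i, hi using Nat.le_induction with
      | base => rfl
      | succ i hi ih => rw [hnone i (hcon i hi), ih]
    obtain ⟨i₀, h⟩ := hpos (f n).2.length
    have h1 := h _ (le_max_left i₀ n)
    have h2 := (hf (max i₀ n)).le_length
    rw [hconst _ (le_max_right i₀ n)] at h2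
    omega
  have hhome : ∀ n, ∃ i, n ≤ i ∧ (q i).1 = .home := by
    intro n
    by_contra hcon
    push Not at hcon
    have hphase : ∀ i, n ≤ i → (q i).1.phase ≤ (q (i + 1)).1.phase ∧
        ((q i).1.lab ≠ none → (q i).1.phase = 3 ∧ (q (i + 1)).1.phase = 4) := by
      intro i hi
      obtain ⟨g, m, ht, -, -⟩ := hstep i
      exact SimState.Trans.phase_le ht (hcon (i + 1) (by omega))
    obtain ⟨i, hi, hl⟩ := hinf n
    obtain ⟨j, hj, hl'⟩ := hinf (i + 1)
    have hmono : ∀ j, i + 1 ≤ j → (q (i + 1)).1.phase ≤ (q j).1.phase := by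
      intro j hj
      induction j, hj using Nat.le_induction with
      | base => exact le_rfl
      | succ j hj ih => exact ih.trans (hphase j (by omega)).1
    have h1 := (hphase i hi).2 hl
    have h2 := (hphase j (by omega)).2 hl'
    have h3 := hmono j hj
    omega
  obtain ⟨S, P, cnt, hst, hS⟩ := exists_stutter (fun i => (f i).2) (fun i => (q i).1.lab)
    hnone hinf
  have hder : ∀ k, G.Step (P k) (S k) (S (k + 1)) := by
    intro k
    obtain ⟨i, hk, hl, hk'⟩ := hst.exists_active k
    have h1 := hS i
    have h2 := hS (i + 1)
    rw [hk] at h1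
    rw [hk'] at h2
    rw [← h1, ← h2]
    rcases hfstep i with h | ⟨p, h, h'⟩
    · simp [hl] at h
    · obtain rfl : P k = p := by simpa [hl] using h
      exact h'
  have hmono : ∀ {j k}, j ≤ k → termPrefix (S j) <+: termPrefix (S k) := by
    intro j k hjk
    induction hjk with
    | refl => exact List.prefix_rfl
    | step _ ih => exact ih.trans (hder _).termPrefix_isPrefix
  have hpre : ∀ j n, ∃ k b, j ≤ k ∧ n ≤ b ∧ (List.range b).map u <+: termPrefix (S k) := by
    intro j n
    obtain ⟨i₀, h⟩ := hpos n
    obtain ⟨i₁, h₁⟩ := hst.unbounded j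
    obtain ⟨i, hi, hq⟩ := hhome (max i₀ i₁)
    have hr := hf i
    rw [hq, hS i] at hr
    obtain ⟨v, hv⟩ := hr.pre_isPrefix
    refine ⟨cnt i, (D i).pos, h₁.trans (hst.mono (le_of_max_le_right hi)),
      (h i (le_of_max_le_left hi)).le, ?_⟩
    rw [← hv, termPrefix_pre_append]
    exact List.prefix_append _ _
  refine ⟨S, P, ?_, hder, fun n => ?_, fun j => ?_,
    (Stutter.isAccepting_iff (X := {q : G.SimState // q.Valid G.bound}) (l := fun q => q.1.lab)
      (d := q) hst σ ρ G.acc).1 hacc⟩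
  · rw [← hst.zero, ← hS, hf0]
  · obtain ⟨k, b, -, hb, h⟩ := hpre 0 n
    refine ⟨k, ?_⟩
    have := h.length_le
    simp only [List.length_map, List.length_range] at this
    omega
  · obtain ⟨k, b, hjk, hb, h⟩ := hpre j (termPrefix (S j)).length
    have hle := List.prefix_of_prefix_length_le (hmono hjk) h (by simpa using hb)
    intro m hm
    have := List.prefix_iff_getElem?.1 hle m hm
    simp only [List.getElem?_map, List.getElem?_range (hm.trans_le hb), Option.map_some,
      Option.some.injEq] at this
    rw [List.get_eq_getElem, this]

end OmegaPSG
namespace OmegaPSG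

variable {T : Type} {G : OmegaPSG T}

namespace SimState

/-- `Good u S P k q t n b μ`: in state `q` with tape `t` and head position `n`, having verified
`b` letters, the machine is simulating step `k` of the derivation `S` with productions `P`;
`μ` measures what remains to be done before the next production is applied. -/
inductive Good (u : ℕ → T) (S : ℕ → List (G.N ⊕ T)) (P : ℕ → G.P) :
    ℕ → G.SimState → (ℕ → T × Option (G.N ⊕ T) × Bool) → ℕ → ℕ → ℕ ×ₗ ℕ → Prop
  | init : Good u S P 0 init (enc u none []) 0 0 (toLex (6, 0))
  | home (k b s) : S k = pre u b ++ s →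
      Good u S P k home (enc u none (pre u b ++ s)) b b (toLex (3, s.length))
  | seek (k b z y v) : pre u b <+: z → (termPrefix (S k)).length ≤ b →
      S (k + 1) = z ++ y ++ G.rhs (P k) ++ v →
      Good u S P k seek (enc u (some b) (z ++ (y ++ ((G.lhs (P k)).map Sum.inl ++ v)))) z.length b
        (toLex (2, y.length))
  | repl (k b z rem queue v) : pre u b <+: z → (termPrefix (S k)).length ≤ b →
      S (k + 1) = z ++ queue ++ v → rem.length ≤ queue.length →
      Good u S P k (repl (P k) rem queue) (enc u (some b) (z ++ (rem.map Sum.inl ++ v))) z.length b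
        (toLex (1, rem.length))
  | app (k b z queue v) : pre u b <+: z → (termPrefix (S k)).length ≤ b →
      S (k + 1) = z ++ queue ++ v →
      Good u S P k (app (P k) queue) (enc u (some b) (z ++ v)) z.length b (toLex (0, 0))
  | shift (k b z queue v) : pre u b <+: z → S k = z ++ queue ++ v →
      Good u S P k (shift queue) (enc u (some b) (z ++ v)) z.length b
        (toLex (5, queue.length + v.length))
  | ret (k b z v) : pre u b <+: z → S k = z ++ v →
      Good u S P k ret (enc u (some b) (z ++ v)) z.length b (toLex (4, z.length))

theorem Good.le_pos {u : ℕ → T} {S : ℕ → List (G.N ⊕ T)} {P : ℕ → G.P} {k n b : ℕ}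
    {q : G.SimState} {t : ℕ → T × Option (G.N ⊕ T) × Bool} {μ : ℕ ×ₗ ℕ}
    (h : Good u S P k q t n b μ) : b ≤ n := by
  have hz : ∀ {z : List (G.N ⊕ T)}, pre u b <+: z → b ≤ z.length := fun h => by
    simpa using h.length_le
  cases h <;> first | exact le_rfl | exact hz ‹_›

theorem Good.step (hG : G.IsCSG) {u : ℕ → T} {S : ℕ → List (G.N ⊕ T)} {P : ℕ → G.P}
    (hS₀ : S 0 = [.inl G.start]) (hS : ∀ k, G.Step (P k) (S k) (S (k + 1)))
    (hu : ∀ k, MatchesPrefix (termPrefix (S k)) u) {k n b : ℕ} {q : G.SimState}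
    {t : ℕ → T × Option (G.N ⊕ T) × Bool} {μ : ℕ ×ₗ ℕ} (hq : q.Valid G.bound)
    (h : Good u S P k q t n b μ) :
    ∃ k' q' g m b' μ', Trans q (t n) q' g m ∧ q'.Valid G.bound ∧
      Good u S P k' q' (Function.update t n g) (moveHead m n) b' μ' ∧ b ≤ b' ∧
      ((q.lab = none ∧ k' = k ∧ μ' < μ) ∨
        (q.lab = some (P k) ∧ k' = k + 1 ∧ (termPrefix (S k)).length ≤ b)) := by
  cases h with
  | init =>
    refine ⟨0, .home, (u 0, some (.inl G.start), false), .S, 0, toLex (3, 1), ?_, trivial, ?_,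
      le_rfl, .inl ⟨rfl, rfl, by simp [Prod.Lex.toLex_lt_toLex]⟩⟩
    · convert Trans.init (u 0) using 1
      simp [enc]
    · have := update_enc_length (u := u) (m := none) [] (.inl G.start : G.N ⊕ T)
      simp only [List.length_nil, reduceCtorEq, decide_false, List.nil_append] at this
      rw [this]
      exact Good.home 0 0 [.inl G.start] hS₀
  | home _ _ s hs =>
    have htp := termPrefix_pre_append (u := u) n s
    rw [← hs] at htp
    by_cases hX : ∃ a v, s = .inr a :: v
    · obtain ⟨a, v, rfl⟩ := hX
      obtain rfl : a = u n := by
        have := hu k n (by rw [htp]; simp [termPrefix])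
        simp only [htp, List.get_eq_getElem, termPrefix] at this
        simpa using this
      refine ⟨k, .home, enc u none (pre u n ++ Sum.inr (u n) :: v) n, .R, n + 1,
        toLex (3, v.length), ?_, trivial, ?_, by omega,
        .inl ⟨rfl, rfl, by simp [Prod.Lex.toLex_lt_toLex]⟩⟩
      · have : enc u none (pre u n ++ Sum.inr (u n) :: v) n = (u n, some (.inr (u n)), false) := by
          simp [enc]
        rw [this]
        exact Trans.advance (u n)
      · rw [Function.update_eq_self]
        have := Good.home (P := P) (u := u) (S := S) k (n + 1) v (by rw [hs, pre_succ]; simp)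
        rwa [pre_succ, List.append_assoc, List.singleton_append] at this
    · have htp' : termPrefix s = [] := by
        rcases s with _ | ⟨A | a, v⟩
        · rfl
        · rfl
        · exact absurd ⟨a, v, rfl⟩ hX
      have hlen : (termPrefix (S k)).length = n := by simp [htp, htp']
      obtain ⟨x, v, h1, h2⟩ := hS k
      obtain ⟨A, l, hl⟩ := List.exists_cons_of_ne_nil (G.lhs_ne (P k))
      have hnx : n ≤ x.length := by
        rw [← hlen]
        exact length_termPrefix_le (A := A) (by simp [h1, hl])
      obtain ⟨y, rfl⟩ : pre u n <+: x := List.prefix_of_prefix_length_le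
        (l₃ := S k) (by rw [hs]; exact List.prefix_append _ _)
        (by rw [h1, List.append_assoc]; exact List.prefix_append _ _) (by simpa using hnx)
      refine ⟨k, .seek, (u n, (pre u n ++ s)[n]?, true), .S, n, toLex (2, y.length),
        Trans.mark _ _, trivial, ?_, le_rfl,
        .inl ⟨rfl, rfl, by simp [Prod.Lex.toLex_lt_toLex]⟩⟩
      rw [update_enc_mark]
      have := Good.seek (P := P) (u := u) (S := S) k n (pre u n) y v List.prefix_rfl hlen.le
        (by rw [h2])
      rw [length_pre] at this
      rw [← hs, h1]
      simpa [moveHead] using this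
  | seek _ _ z y v hz htp hs =>
    rcases y with _ | ⟨X, y⟩
    · have hB := G.length_add_length_le_bound (P k)
      refine ⟨k, .repl (P k) (G.lhs (P k)) (G.rhs (P k)), _, .S, b,
        toLex (1, (G.lhs (P k)).length), Trans.pick _ _, ⟨by omega, by omega⟩, ?_,
        le_rfl, .inl ⟨rfl, rfl, ?_⟩⟩
      · rw [Function.update_eq_self]
        exact Good.repl k b z _ _ v hz htp (by simpa using hs) (hG _)
      · simp [Prod.Lex.toLex_lt_toLex]
    · refine ⟨k, .seek, (u z.length, some X, decide (some b = some z.length)), .R, b,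
        toLex (2, y.length), ?_, trivial, ?_, le_rfl,
        .inl ⟨rfl, rfl, by simp [Prod.Lex.toLex_lt_toLex]⟩⟩
      · convert Trans.skip (u z.length) X (decide (some b = some z.length)) using 1
        simp [enc]
      · rw [List.cons_append, update_enc_cons]
        have := Good.seek (P := P) (u := u) (S := S) k b (z ++ [X]) y v
          (hz.trans (List.prefix_append _ _)) htp (by simpa using hs)
        simpa [moveHead] using this
  | repl _ _ z rem queue v hz htp hs hle =>
    rcases rem with _ | ⟨A, rem⟩
    · refine ⟨k, .app (P k) queue, _, .S, b, toLex (0, 0), Trans.found _ _ _, hq.2, ?_, le_rfl,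
        .inl ⟨rfl, rfl, by simp [Prod.Lex.toLex_lt_toLex]⟩⟩
      rw [Function.update_eq_self]
      exact Good.app k b z queue v hz htp hs
    · rcases queue with _ | ⟨w, queue⟩
      · simp at hle
      · simp only [List.length_cons] at hle
        obtain ⟨hq₁, hq₂⟩ := hq
        simp only [List.length_cons] at hq₁ hq₂
        refine ⟨k, .repl (P k) rem queue, (u z.length, some w, decide (some b = some z.length)),
          .R, b, toLex (1, rem.length), ?_, ⟨by omega, by omega⟩, ?_, le_rfl,
          .inl ⟨rfl, rfl, by simp [Prod.Lex.toLex_lt_toLex]⟩⟩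
        · convert Trans.repl (P k) A rem w queue (u z.length) (decide (some b = some z.length))
            using 1
          simp [enc]
        · rw [List.map_cons, List.cons_append, update_enc_cons]
          have := Good.repl (P := P) (u := u) (S := S) k b (z ++ [w]) rem queue v
            (hz.trans (List.prefix_append _ _)) htp (by simpa using hs) (by omega)
          simpa [moveHead] using this
  | app _ _ z queue v hz htp hs =>
    refine ⟨k + 1, .shift queue, _, .S, b, toLex (5, queue.length + v.length),
      Trans.app _ _ _, hq, ?_, le_rfl, .inr ⟨rfl, rfl, htp⟩⟩
    rw [Function.update_eq_self]
    exact Good.shift (k + 1) b z queue v hz hs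
  | shift _ _ z queue v hz hs =>
    rcases queue with _ | ⟨w, queue⟩
    · refine ⟨k, .ret, _, .S, b, toLex (4, z.length), Trans.finish _, trivial, ?_, le_rfl,
        .inl ⟨rfl, rfl, by simp [Prod.Lex.toLex_lt_toLex]⟩⟩
      rw [Function.update_eq_self]
      exact Good.ret k b z v hz (by simpa using hs)
    · rcases v with _ | ⟨Y, v⟩
      · refine ⟨k, .shift queue, (u z.length, some w, decide (some b = some z.length)), .R, b,
          toLex (5, queue.length), ?_, ?_, ?_, le_rfl,
          .inl ⟨rfl, rfl, by simp [Prod.Lex.toLex_lt_toLex]⟩⟩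
        · convert Trans.put w queue (u z.length) (decide (some b = some z.length)) using 1
          simp [enc]
        · exact (Nat.le_succ _).trans hq
        · rw [List.append_nil, update_enc_length]
          have := Good.shift (P := P) (u := u) (S := S) k b (z ++ [w]) queue []
            (hz.trans (List.prefix_append _ _)) (by simpa using hs)
          simpa [moveHead] using this
      · refine ⟨k, .shift (queue ++ [Y]), (u z.length, some w, decide (some b = some z.length)),
          .R, b, toLex (5, (queue ++ [Y]).length + v.length), ?_, ?_, ?_, le_rfl,
          .inl ⟨rfl, rfl, by simp [Prod.Lex.toLex_lt_toLex]⟩⟩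
        · convert Trans.carry w queue (u z.length) Y (decide (some b = some z.length)) using 1
          simp [enc]
        · simpa [Valid] using hq
        · rw [update_enc_cons]
          have := Good.shift (P := P) (u := u) (S := S) k b (z ++ [w]) (queue ++ [Y]) v
            (hz.trans (List.prefix_append _ _)) (by simpa using hs)
          simpa [moveHead] using this
  | ret _ _ z v hz hs =>
    have hlen := hz.length_le
    rw [length_pre] at hlen
    by_cases hb : b = z.length
    · obtain rfl : pre u b = z := hz.eq_of_length (by simp [hb])
      refine ⟨k, .home, (u b, (pre u b ++ v)[b]?, false), .S, b, toLex (3, v.length), ?_,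
        trivial, ?_, le_rfl, .inl ⟨rfl, rfl, by simp [Prod.Lex.toLex_lt_toLex]⟩⟩
      · convert Trans.halt (u b) ((pre u b ++ v)[b]?) using 1
        simp [enc]
      · simp only [length_pre, moveHead]
        rw [update_enc_unmark]
        exact Good.home k b v hs
    · rcases List.eq_nil_or_concat z with rfl | ⟨z, Y, rfl⟩
      · simp at hlen hb
        exact absurd hlen hb
      · simp only [List.concat_eq_append, List.length_append, List.length_singleton] at *
        refine ⟨k, .ret, enc u (some b) (z ++ [Y] ++ v) (z.length + 1), .L, b,
          toLex (4, z.length), ?_,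
          trivial, ?_, le_rfl, .inl ⟨rfl, rfl, by simp [Prod.Lex.toLex_lt_toLex]⟩⟩
        · have : enc u (some b) (z ++ [Y] ++ v) (z.length + 1) =
              (u (z.length + 1), (z ++ [Y] ++ v)[z.length + 1]?, false) := by
            simp [enc, hb]
          rw [this]
          exact Trans.back _ _
        · rw [Function.update_eq_self]
          have := Good.ret (P := P) (u := u) (S := S) k b z (Y :: v)
            (List.prefix_of_prefix_length_le hz (List.prefix_append _ _)
              (by rw [length_pre]; omega)) (by simpa using hs)
          simpa [moveHead] using this

end SimState

theorem lang_subset_toTM [Finite T] (hG : G.IsCSG) (σ : AccSigma) (ρ : AccRho) :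
    G.Lang σ ρ .nl ⊆ (G.toTM ρ).Lang σ ρ := by
  rintro u ⟨S, P, hS₀, hS, hunb, hu, hacc⟩
  obtain ⟨f, hf0, hf, hfstep⟩ := exists_seq_of_forall_exists
    (P := fun x : ℕ × (G.toTM ρ).Cfg × ℕ × (ℕ ×ₗ ℕ) =>
      SimState.Good u S P x.1 x.2.1.q.1 x.2.1.tape x.2.1.pos x.2.2.1 x.2.2.2)
    (R := fun x y => (G.toTM ρ).CfgStep x.2.1 y.2.1 ∧ x.2.2.1 ≤ y.2.2.1 ∧
      ((x.2.1.q.1.lab = none ∧ y.1 = x.1 ∧ y.2.2.2 < x.2.2.2) ∨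
        (x.2.1.q.1.lab = some (P x.1) ∧ y.1 = x.1 + 1 ∧
          (termPrefix (S x.1)).length ≤ x.2.2.1)))
    (x₀ := (0, ⟨⟨.init, trivial⟩, enc u none [], 0⟩, 0, toLex (6, 0)))
    SimState.Good.init (by
      rintro ⟨k, ⟨q, t, n⟩, b, μ⟩ hgood
      obtain ⟨k', q', g, m, b', μ', ht, hq', hgood', hb, h⟩ := hgood.step hG hS₀ hS hu q.2
      exact ⟨(k', ⟨⟨q', hq'⟩, _, _⟩, b', μ'), hgood', ⟨g, m, ht, rfl, rfl⟩, hb, h⟩)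
  let q : ℕ → {q : G.SimState // q.Valid G.bound} := fun i => (f i).2.1.q
  have hst : Stutter (fun i => (q i).1.lab) P fun i => (f i).1 := by
    refine ⟨by rw [hf0], fun i => ?_, unbounded_of_measure _ (fun i => (f i).2.2.2) fun i => ?_⟩
    · rcases (hfstep i).2.2 with ⟨h1, h2, -⟩ | ⟨h1, h2, -⟩
      · exact .inl ⟨h1, h2⟩
      · exact .inr ⟨h1, h2⟩
    · rcases (hfstep i).2.2 with ⟨-, h1, h2⟩ | ⟨-, h1, -⟩
      · exact .inl ⟨h1, h2⟩
      · exact .inr h1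
  have hmono : Monotone fun i => (f i).2.2.1 := monotone_nat_of_le_succ fun i => (hfstep i).2.1
  refine (G.toTM ρ).mem_lang_iff.2 ⟨fun i => (f i).2.1, ?_, fun i => (hfstep i).1, fun n => ?_,
    (Stutter.isAccepting_iff (X := {q : G.SimState // q.Valid G.bound}) (l := fun q => q.1.lab)
      (d := q) hst σ ρ G.acc).2 hacc⟩
  · exact (congrArg (fun x => x.2.1) hf0).trans (initCfg_toTM ..).symm
  · obtain ⟨k, hk⟩ := hunb (n + 1)
    obtain ⟨i, hik, -, hik'⟩ := hst.exists_active k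
    refine ⟨i, fun j hj => ?_⟩
    have h1 := (hf j).le_pos
    have h2 := hmono hj
    dsimp only at h2 ⊢
    rcases (hfstep i).2.2 with ⟨-, h, -⟩ | ⟨-, -, h⟩
    · omega
    · rw [hik] at h
      omega

theorem lang_toTM [Finite T] (hG : G.IsCSG) (σ : AccSigma) (ρ : AccRho) :
    (G.toTM ρ).Lang σ ρ = G.Lang σ ρ .nl :=
  (lang_toTM_subset σ ρ).antisymm (lang_subset_toTM hG σ ρ)

end OmegaPSG
end OmegaFormal

/-- Theorem: 𝓛_{σ,ρ,nl}(ω-CSG) = 𝓛_{σ,ρ}(ω-TM) for every acceptance mode (σ,ρ). -/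
theorem csg_nl_eq_tm (T : Type) [Fintype T] (σ : AccSigma) (ρ : AccRho) :
    GLang T OmegaPSG.IsCSG σ ρ DerivMode.nl = TMLang T σ ρ := by
  ext L
  constructor
  · rintro ⟨G, hG, rfl⟩
    exact ⟨G.toTM ρ, (OmegaPSG.lang_toTM hG σ ρ).symm⟩
  · rintro ⟨M, rfl⟩
    exact ⟨M.toGrammar ρ, M.toGrammar_isCSG ρ, (M.lang_toGrammar σ ρ).symm⟩
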